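/- arXiv:1706.03844 — 2 statements merged into one kernel-verified Lean document; each statement's English description precedes it below -/
import Mathlib

section
/- (Key Lemma) Let G be a discrete group and let Λ ⊆ G \ {1} be a symmetric set (Λ⁻¹ = Λ) which is completely Sidon with constant C. Let A be a unital C*-algebra and let φ : Λ → A be a Hermitian function (φ(t⁻¹) = star(φ(t)) for all t ∈ Λ) with sup_{t∈Λ} ‖φ(t)‖ < 1. Then for every real ε with 0 ≤ ε ≤ 1 there exists a completely positive definite function Φ_ε : G → A such that ‖Φ_ε(1)‖ ≤ 4C² and ‖Φ_ε(s) − ε • φ(s)‖ ≤ 4C²·ε² for every s ∈ Λ. -/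
/-- The operator `Op(a,v)` on the ℓ²-direct sum of `N` copies of `H`. -/
noncomputable def sidonOp {G : Type} {Λ : Set G} {N : ℕ}
    (a : ↥Λ →₀ Matrix (Fin N) (Fin N) ℂ)
    {H : Type} [NormedAddCommGroup H] [InnerProductSpace ℂ H]
    (v : ↥Λ → H →L[ℂ] H) :
    PiLp 2 (fun _ : Fin N => H) →L[ℂ] PiLp 2 (fun _ : Fin N => H) :=
  (((PiLp.continuousLinearEquiv 2 ℂ (fun _ : Fin N => H)).symm :
      (Fin N → H) →L[ℂ] PiLp 2 (fun _ : Fin N => H)).comp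
    ((ContinuousLinearMap.pi fun i =>
        ∑ t ∈ a.support, ∑ j, (a t i j) • ((v t).comp (ContinuousLinearMap.proj j))).comp
      (((PiLp.continuousLinearEquiv 2 ℂ (fun _ : Fin N => H)) :
        PiLp 2 (fun _ : Fin N => H) →L[ℂ] (Fin N → H)))))

/-- `Λ ⊆ G` is completely Sidon with constant `C`. -/
def IsCompletelySidon {G : Type} [Group G] (Λ : Set G) (C : ℝ) : Prop :=
  ∀ (N : ℕ) (a : ↥Λ →₀ Matrix (Fin N) (Fin N) ℂ) (D : ℝ), 0 ≤ D →
    (∀ (H' : Type) [NormedAddCommGroup H'] [InnerProductSpace ℂ H'] [CompleteSpace H']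
        (π : G →* unitary (H' →L[ℂ] H')),
        ‖sidonOp a (fun t => ((π (t : G) : unitary (H' →L[ℂ] H')) : H' →L[ℂ] H'))‖ ≤ D) →
    ∀ (K : Type) [NormedAddCommGroup K] [InnerProductSpace ℂ K] [CompleteSpace K]
      (u : ↥Λ → unitary (K →L[ℂ] K)),
      ‖sidonOp a (fun t => ((u t : unitary (K →L[ℂ] K)) : K →L[ℂ] K))‖ ≤ C * D
/-- An `A`-valued function on a group is completely positive definite: for every `n` and
`t : Fin n → G`, the matrix `(f ((t i)⁻¹ * t j))` is a nonnegative element of the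
C*-algebra of `n × n` matrices over `A`, i.e. of the form `Bᴴ * B`. -/
def IsCompletelyPosDefFn {G A : Type} [Group G] [CStarAlgebra A] (f : G → A) : Prop :=
  ∀ (n : ℕ) (t : Fin n → G), ∃ B : Matrix (Fin n) (Fin n) A,
    Matrix.of (fun i j : Fin n => f ((t i)⁻¹ * t j)) = B.conjTranspose * B



open scoped ComplexOrder

/-- Positive semidefinite kernel with values in an ordered star ring. -/
def KPos {ι A : Type} [NonUnitalRing A] [StarRing A] [LE A] (k : ι → ι → A) : Prop :=
  ∀ (n : ℕ) (t : Fin n → ι) (z : Fin n → A),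
    0 ≤ ∑ i, ∑ j, star (z i) * k (t i) (t j) * z j

namespace KPos

section basic
variable {ι A : Type} [NonUnitalRing A] [StarRing A] [PartialOrder A]

theorem fin {k : ι → ι → A} (hk : KPos k) {κ : Type} [Fintype κ] (t : κ → ι) (z : κ → A) :
    0 ≤ ∑ i, ∑ j, star (z i) * k (t i) (t j) * z j := by
  have h := hk (Fintype.card κ) (t ∘ (Fintype.equivFin κ).symm) (z ∘ (Fintype.equivFin κ).symm)
  refine h.trans_eq ?_
  refine Fintype.sum_equiv (Fintype.equivFin κ).symm _ _ fun i => ?_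
  exact Fintype.sum_equiv (Fintype.equivFin κ).symm _ _ fun j => rfl

theorem finset {k : ι → ι → A} (hk : KPos k) (s : Finset ι) (z : ι → A) :
    0 ≤ ∑ i ∈ s, ∑ j ∈ s, star (z i) * k i j * z j := by
  have h := hk.fin (fun i : s => (i : ι)) (fun i : s => z i)
  refine h.trans_eq ?_
  rw [← Finset.sum_coe_sort s]
  refine Finset.sum_congr rfl fun i _ => ?_
  rw [← Finset.sum_coe_sort s]

theorem comp {κ : Type} {k : ι → ι → A} (hk : KPos k) (f : κ → ι) :
    KPos (fun i j => k (f i) (f j)) := fun n t z => hk n (f ∘ t) z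

theorem add [IsOrderedAddMonoid A] {k l : ι → ι → A} (hk : KPos k) (hl : KPos l) :
    KPos (fun i j => k i j + l i j) := fun n t z => by
  refine (add_nonneg (hk n t z) (hl n t z)).trans_eq ?_
  simp only [mul_add, add_mul, Finset.sum_add_distrib]

theorem congr {k l : ι → ι → A} (hk : KPos k) (h : ∀ i j, l i j = k i j) : KPos l := by
  have : l = k := by ext i j; exact h i j
  rwa [this]

end basic

section cstar
variable {ι A : Type} [CStarAlgebra A] [PartialOrder A] [StarOrderedRing A]

theorem herm {k : ι → ι → A} (hk : KPos k) (i j : ι) : star (k i j) = k j i := by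
  have h0 : ∀ a : A, 0 ≤ star a * k i i * a := fun a => by
    simpa using hk 1 ![i] ![a]
  have h0' : ∀ a : A, 0 ≤ star a * k j j * a := fun a => by
    simpa using hk 1 ![j] ![a]
  have hi : star (k i i) = k i i := by simpa using (h0 1).isSelfAdjoint.star_eq
  have hj : star (k j j) = k j j := by simpa using (h0' 1).isSelfAdjoint.star_eq
  have h1 := (hk 2 ![i, j] ![1, 1]).isSelfAdjoint.star_eq
  have h2 := (hk 2 ![i, j] ![1, algebraMap ℂ A Complex.I]).isSelfAdjoint.star_eq
  simp only [Fin.sum_univ_two] at h1 h2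
  simp [hi, hj, Algebra.algebraMap_eq_smul_one, smul_smul] at h1 h2
  have e1 : star (k i j) + star (k j i) = k i j + k j i := by
    have : (k i i + star (k j i) + (star (k i j) + k j j)) -(k i i + k j j)= (k i i + k i j + (k j i + k j j)) - (k i i + k j j) := by rw [← h1]; abel
    calc _ = (k i i + star (k j i) + (star (k i j) + k j j)) -(k i i + k j j) := by abel
      _ = _ := by exact this.trans (by abel)
  have e2 : Complex.I • (star (k j i) - star (k i j)) = Complex.I • (k i j - k j i) := by
    rw [smul_sub, smul_sub]
    have := congrArg (fun x => x - (k i i + k j j)) h2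
    beta_reduce at this
    calc _ = _ - (k i i + k j j) := by abel
      _ = _ := this
      _ = _ := by abel
  have e3 := (smul_right_injective A Complex.I_ne_zero) e2
  have e4 : (2:ℂ) • star (k i j) = (2:ℂ) • k j i := by
    rw [two_smul, two_smul]
    calc _ = (star (k i j) + star (k j i)) - (star (k j i) - star (k i j)) := by abel
      _ = (k i j + k j i) - (k i j - k j i) := by rw [e1, e3]
      _ = _ := by abel
  exact (smul_right_injective A (two_ne_zero)) e4

theorem const_mul {k : ι → ι → A} (hk : KPos k) (b : ι → A) :
    KPos (fun i j => star (b i) * k i j * b j) := fun n t z => by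
  refine (hk n t (fun i => b (t i) * z i)).trans_eq ?_
  simp only [star_mul, mul_assoc]

end cstar

theorem posSemidef {ι : Type} {X : ι → ι → ℂ} (hX : KPos X) : (Matrix.of X).PosSemidef := by
  refine ⟨?_, fun x => ?_⟩
  · ext i j
    simpa using hX.herm j i
  · simpa [Finsupp.sum] using hX.finset x.support x

theorem of_posSemidef {ι : Type} {X : ι → ι → ℂ} (hX : (Matrix.of X).PosSemidef) : KPos X := by
  intro n t z
  have := (hX.submatrix t).dotProduct_mulVec_nonneg z
  refine this.trans_eq ?_
  simp [dotProduct, Matrix.mulVec, Finset.mul_sum, mul_assoc]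

theorem gram {ι H : Type} [NormedAddCommGroup H] [InnerProductSpace ℂ H] (v : ι → H) :
    KPos (fun i j => inner ℂ (v i) (v j)) := by
  intro n t z
  have : ∑ i, ∑ j, star (z i) * inner ℂ (v (t i)) (v (t j)) * z j
      = inner ℂ (∑ i, z i • v (t i)) (∑ j, z j • v (t j)) := by
    rw [sum_inner]
    simp only [inner_sum, inner_smul_left, inner_smul_right]
    refine Finset.sum_congr rfl fun i _ => Finset.sum_congr rfl fun j _ => ?_
    simp; ring
  rw [this, inner_self_eq_norm_sq_to_K]
  have : (0:ℂ) ≤ ((‖∑ i, z i • v (t i)‖ ^ 2 : ℝ) : ℂ) := Complex.zero_le_real.2 (sq_nonneg _)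
  rw [Complex.ofReal_pow] at this
  exact this

/-- Schur product. -/
theorem schur {ι A : Type} [CStarAlgebra A] [PartialOrder A] [StarOrderedRing A]
    {X : ι → ι → ℂ} (hX : KPos X) {k : ι → ι → A} (hk : KPos k) :
    KPos (fun i j => X i j • k i j) := by
  intro n t z
  have h1 : ((Matrix.of X).submatrix t t).PosSemidef := hX.posSemidef.submatrix t
  obtain ⟨B, hB⟩ : ∃ B : Matrix (Fin n) (Fin n) ℂ, (Matrix.of X).submatrix t t = B.conjTranspose * B := by
    open scoped MatrixOrder Matrix.Norms.L2Operator in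
    exact CStarAlgebra.nonneg_iff_eq_star_mul_self.mp h1.nonneg
  have h2 : ∀ i j, X (t i) (t j) = ∑ c, star (B c i) * B c j := fun i j => by
    have := congrFun (congrFun hB i) j
    simpa [Matrix.mul_apply] using this
  have h3 : ∑ i, ∑ j, star (z i) * (X (t i) (t j) • k (t i) (t j)) * z j
     = ∑ c, ∑ i, ∑ j, star (B c i • z i) * k (t i) (t j) * (B c j • z j) := by
    rw [Finset.sum_comm_cycle, Finset.sum_comm_cycle]
    refine Finset.sum_congr rfl fun i _ => Finset.sum_congr rfl fun j _ => ?_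
    rw [h2, Finset.sum_smul, Finset.mul_sum, Finset.sum_mul]
    refine Finset.sum_congr rfl fun c _ => ?_
    simp [smul_smul, mul_comm]
  rw [h3]
  exact Finset.sum_nonneg fun c _ => hk n t fun i => B c i • z i

theorem exists_decomp {D : Type} [CStarAlgebra D] [PartialOrder D] [StarOrderedRing D]
    (M : D) (hM : IsSelfAdjoint M) :
    ∃ P N : D, 0 ≤ P ∧ 0 ≤ N ∧ M = P - N ∧ N * P = 0 :=
  ⟨M⁺, M⁻, CFC.posPart_nonneg M, CFC.negPart_nonneg M, (CFC.posPart_sub_negPart M hM).symm,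
    CFC.negPart_mul_posPart M⟩

theorem exists_star_mul {D : Type} [CStarAlgebra D] [PartialOrder D] [StarOrderedRing D]
    (M : D) (hM : 0 ≤ M) : ∃ N : D, M = star N * N :=
  CStarAlgebra.nonneg_iff_eq_star_mul_self.mp hM

/-- Finite positive kernels over a C*-algebra factor as `Bᴴ * B`. -/
theorem factor {A : Type} [CStarAlgebra A] [PartialOrder A] [StarOrderedRing A] {n : ℕ}
    {k : Fin n → Fin n → A} (hk : KPos k) :
    ∃ B : Matrix (Fin n) (Fin n) A, Matrix.of k = B.conjTranspose * B := by
  set M : CStarMatrix (Fin n) (Fin n) A := CStarMatrix.ofMatrix (Matrix.of k) with hM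
  have hMa : ∀ i j, M i j = k i j := fun i j => rfl
  have hsa : IsSelfAdjoint M := by
    ext i j
    simp [CStarMatrix.star_apply, hMa, hk.herm]
  have key : ∀ N : CStarMatrix (Fin n) (Fin n) A, ∀ c, (star N * N) c c = 0 → ∀ d, N d c = 0 := by
    intro N c h d
    rw [CStarMatrix.mul_apply] at h
    have h' : ∀ x ∈ Finset.univ, 0 ≤ star N c x * N x c := fun x _ => by
      rw [CStarMatrix.star_apply]; exact star_mul_self_nonneg _
    have := (Finset.sum_eq_zero_iff_of_nonneg h').1 h d (Finset.mem_univ _)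
    rw [CStarMatrix.star_apply] at this
    exact CStarRing.star_mul_self_eq_zero_iff _ |>.1 this
  obtain ⟨P, Q, hP, hQ, hPQ, hQP⟩ := exists_decomp M hsa
  have hneg : Q = 0 := by
    have hsn : star Q = Q := hQ.isSelfAdjoint.star_eq
    have hp : 0 ≤ Q * Q * Q := by
      have := star_left_conjugate_nonneg hQ Q
      rwa [hsn] at this
    obtain ⟨N, hN⟩ := exists_star_mul _ hp
    have hM' : M = P - Q := hPQ
    have hQP' : Q * P = 0 := hQP
    have e : Q * M * Q = - (star N * N) := by
      have hN' : Q * Q * Q = star N * N := hN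
      rw [← hN', hM', mul_sub, hQP']
      simp
    have hz : ∀ c, (star N * N) c c = 0 := by
      intro c
      apply le_antisymm
      · have h2 := hk n id (fun i => Q i c)
        have h3 : ∑ i, ∑ j, star (Q i c) * k (id i) (id j) * Q j c = (Q * M * Q) c c := by
          simp only [CStarMatrix.mul_apply, Finset.sum_mul]
          rw [Finset.sum_comm]
          refine Finset.sum_congr rfl fun i _ => Finset.sum_congr rfl fun j _ => ?_
          rw [← CStarMatrix.star_apply, hsn]; rfl
        rw [h3, e] at h2
        simpa using h2
      · rw [CStarMatrix.mul_apply]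
        refine Finset.sum_nonneg fun x _ => ?_
        rw [CStarMatrix.star_apply]; exact star_mul_self_nonneg _
    have hN0 : N = 0 := by ext d c; exact key N c (hz c) d
    have h3 : Q * Q * Q = 0 := by
      have hN' : Q * Q * Q = star N * N := hN
      rw [hN', hN0]; simp
    have h4 : star (Q * Q) * (Q * Q) = 0 := by
      rw [star_mul, hsn, ← mul_assoc, h3, zero_mul]
    have h5 : star Q * Q = 0 := by rw [hsn]; exact CStarRing.star_mul_self_eq_zero_iff _ |>.1 h4
    exact CStarRing.star_mul_self_eq_zero_iff _ |>.1 h5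
  have hpos : 0 ≤ M := by
    have hM' : M = P - Q := hPQ
    rw [hM', hneg, sub_zero]; exact hP
  obtain ⟨N, hN⟩ := exists_star_mul _ hpos
  exact ⟨CStarMatrix.ofMatrix.symm N, hN⟩

/-- Kolmogorov decomposition. -/
theorem kolmogorov {J : Type} {X : J → J → ℂ} (hX : KPos X) :
    ∃ (R : Type) (_ : NormedAddCommGroup R) (_ : InnerProductSpace ℂ R) (_ : CompleteSpace R)
      (k : J → R), ∀ i j, inner ℂ (k i) (k j) = X i j := by
  let K : Matrix J J (ℂ →L[ℂ] ℂ) := Matrix.of fun i j => X i j • ContinuousLinearMap.id ℂ ℂ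
  have hK : K.PosSemidef := by
    refine ((RKHS.posSemidef_tfae (K := K)).out 0 1).mpr (And.intro ?_ ?_)
    · ext i j
      have h1 : star (ContinuousLinearMap.id ℂ ℂ) = ContinuousLinearMap.id ℂ ℂ := star_one _
      simp [K, h1]
      simpa using hX.herm j i
    · intro f
      have h := hX.fin (fun i : f.support => i.1.1) (fun i : f.support => f i.1 * i.1.2)
      have h' := (Complex.le_def.1 h).1
      simp only [Complex.zero_re] at h'
      refine h'.trans_eq ?_
      show _ = Complex.re _
      congr 1
      rw [Finsupp.sum, ← Finset.sum_coe_sort f.support]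
      refine Finset.sum_congr rfl fun i _ => ?_
      rw [Finsupp.sum, ← Finset.sum_coe_sort f.support]
      refine Finset.sum_congr rfl fun j _ => ?_
      have := hX.herm j.1.1 i.1.1
      simp [K] at this ⊢
      rw [← this]; ring
  have : Fact K.PosSemidef := ⟨hK⟩
  refine ⟨RKHS.OfKernel K, inferInstance, inferInstance, inferInstance,
    fun j => RKHS.kerFun (𝕜 := ℂ) (RKHS.OfKernel K) j (1 : ℂ), fun i j => ?_⟩
  rw [RKHS.kerFun_inner, RKHS.kerFun_apply, RKHS.OfKernel.kernel_ofKernel]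
  simp [K]

end KPos


theorem freeGroup_sep {α : Type} (S : Finset (FreeGroup α)) :
    ∃ (n : ℕ) (σ : FreeGroup α →* Equiv.Perm (Fin n)), 0 < n ∧
      ∀ w ∈ S, w ≠ 1 → ∀ a, σ w a ≠ a := by
  classical
  let B : Finset (FreeGroup α) :=
    S.biUnion (fun w => (w.toWord.tails.map FreeGroup.mk).toFinset) ∪ {1}
  have h1B : (1 : FreeGroup α) ∈ B := by simp [B]
  let e : ∀ t : α, {v : B // FreeGroup.of t * (v : FreeGroup α) ∈ B} ≃
      {v : B // (FreeGroup.of t)⁻¹ * (v : FreeGroup α) ∈ B} := fun t =>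
    { toFun := fun v => ⟨⟨FreeGroup.of t * v.1.1, v.2⟩, by simp⟩
      invFun := fun v => ⟨⟨(FreeGroup.of t)⁻¹ * v.1.1, v.2⟩, by simp⟩
      left_inv := fun v => by ext; simp
      right_inv := fun v => by ext; simp }
  let τ : α → Equiv.Perm B := fun t => (e t).extendSubtype
  have hτ : ∀ t (v : B), FreeGroup.of t * (v : FreeGroup α) ∈ B →
      (τ t v : FreeGroup α) = FreeGroup.of t * v := fun t v hv' => by
    exact congrArg Subtype.val (Equiv.extendSubtype_apply_of_mem (e t) v hv')
  let σ₀ : FreeGroup α →* Equiv.Perm B := FreeGroup.lift τ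
  have key : ∀ L : List (α × Bool), (∀ L', L' <:+ L → FreeGroup.mk L' ∈ B) →
      (σ₀ (FreeGroup.mk L) ⟨1, h1B⟩ : FreeGroup α) = FreeGroup.mk L := by
    intro L
    induction L with
    | nil =>
      intro h
      rw [← FreeGroup.one_eq_mk]; simp
    | cons x L ih =>
      intro h
      have ih' := ih (fun L' hL' => h L' (hL'.trans (List.suffix_cons _ _)))
      have hc := h _ List.suffix_rfl
      have e1 : FreeGroup.mk (x :: L) = FreeGroup.mk [x] * FreeGroup.mk L := by simp
      rw [e1] at hc ⊢
      rw [map_mul, Equiv.Perm.mul_apply]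
      generalize hv : σ₀ (FreeGroup.mk L) ⟨1, h1B⟩ = v at ih' ⊢
      rw [← ih'] at hc ⊢
      rcases x with ⟨t, b⟩
      cases b
      · have e2 : FreeGroup.mk [(t, false)] = (FreeGroup.of t)⁻¹ := by
          simp [FreeGroup.of, FreeGroup.invRev]
        rw [e2] at hc ⊢
        have h5 : σ₀ (FreeGroup.of t) = τ t := by simp [σ₀]
        have h6 := hτ t ⟨_, hc⟩ (by simp)
        have h7 : τ t ⟨_, hc⟩ = v := by ext; rw [h6]; simp
        have h8 : (τ t)⁻¹ v = ⟨_, hc⟩ := by rw [Equiv.Perm.inv_eq_iff_eq, h7]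
        rw [map_inv, h5, h8]
      · have e2 : FreeGroup.mk [(t, true)] = FreeGroup.of t := rfl
        rw [e2] at hc ⊢
        have h5 : σ₀ (FreeGroup.of t) = τ t := by simp [σ₀]
        rw [h5, hτ t v hc]
  have hne : ∀ w ∈ S, w ≠ 1 → σ₀ w ≠ 1 := by
    intro w hw hw1 h
    have hk := key w.toWord (fun L' hL' => by
      simp only [B, Finset.mem_union, Finset.mem_biUnion, List.mem_toFinset, List.mem_map, List.mem_tails]
      exact Or.inl ⟨w, hw, L', hL', rfl⟩)
    have h2 : FreeGroup.mk w.toWord = w := FreeGroup.mk_toWord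
    rw [h2, h] at hk
    exact hw1 hk.symm
  let Q := Equiv.Perm B
  let ρ : Q →* Equiv.Perm Q := MulAction.toPermHom Q Q
  let eQ : Q ≃ Fin (Fintype.card Q) := Fintype.equivFin Q
  refine ⟨Fintype.card Q, (eQ.permCongrHom.toMonoidHom.comp ρ).comp σ₀, Fintype.card_pos, ?_⟩
  intro w hw hw1 a ha
  apply hne w hw hw1
  have : eQ (σ₀ w * eQ.symm a) = a := ha
  have h2 : σ₀ w * eQ.symm a = eQ.symm a := by rw [Equiv.eq_symm_apply]; exact this
  exact mul_eq_right.1 h2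


open scoped ComplexOrder

namespace KPos

theorem block {ι β A : Type} [CStarAlgebra A] [PartialOrder A] [StarOrderedRing A]
    [DecidableEq β] (f : ι → β)
    (k : β → ι → ι → A) (hk : ∀ b, KPos (k b)) :
    KPos (fun i j => if f i = f j then k (f i) i j else 0) := by
  intro n t z
  have h : ∑ i, ∑ j, star (z i) * (if f (t i) = f (t j) then k (f (t i)) (t i) (t j) else 0) * z j
      = ∑ b ∈ Finset.univ.image (fun i => f (t i)), ∑ i, ∑ j,
        star (if f (t i) = b then z i else 0) * k b (t i) (t j) *
          (if f (t j) = b then z j else 0) := by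
    symm
    rw [Finset.sum_comm]
    refine Finset.sum_congr rfl fun i _ => ?_
    rw [Finset.sum_comm]
    refine Finset.sum_congr rfl fun j _ => ?_
    rw [Finset.sum_eq_single (f (t i))]
    · by_cases hij : f (t j) = f (t i)
      · simp [hij]
      · simp [hij, Ne.symm hij]
    · intro b _ hb
      simp [Ne.symm hb]
    · intro h
      exact absurd (Finset.mem_image_of_mem _ (Finset.mem_univ i)) h
  rw [h]
  exact Finset.sum_nonneg fun b _ => hk b n t _

theorem const {ι A : Type} [CStarAlgebra A] [PartialOrder A] [StarOrderedRing A]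
    {a : A} (ha : 0 ≤ a) : KPos (fun _ _ : ι => a) := by
  intro n t z
  have := star_left_conjugate_nonneg ha (∑ i, z i)
  refine this.trans_eq ?_
  simp only [star_sum, Finset.sum_mul, Finset.mul_sum]
  rw [Finset.sum_comm]

end KPos

section haag
variable {α A : Type} [CStarAlgebra A]

/-- value of a letter -/
def lett (c : α → A) (x : α × Bool) : A := if x.2 then c x.1 else star (c x.1)

/-- value of a word -/
def wordVal (c : α → A) (L : List (α × Bool)) : A := (L.map (lett c)).prod

theorem wordVal_nil (c : α → A) : wordVal c [] = 1 := rfl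
theorem wordVal_cons (c : α → A) (x) (L) : wordVal c (x :: L) = lett c x * wordVal c L := by
  simp [wordVal]
theorem wordVal_append (c : α → A) (L L') :
    wordVal c (L ++ L') = wordVal c L * wordVal c L' := by
  simp [wordVal]

theorem wordVal_invRev (c : α → A) (L) : wordVal c (FreeGroup.invRev L) = star (wordVal c L) := by
  induction L with
  | nil => simp [wordVal]
  | cons x L ih =>
    have : FreeGroup.invRev (x :: L) = FreeGroup.invRev L ++ [(x.1, !x.2)] := by
      simp [FreeGroup.invRev]
    rw [this, wordVal_append, ih, wordVal_cons, wordVal_cons, wordVal_nil, star_mul, mul_one]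
    rcases x with ⟨t, b⟩
    cases b <;> simp [lett]

variable [DecidableEq α]

/-- Haagerup-type function -/
def haag (c : α → A) (w : FreeGroup α) : A := wordVal c w.toWord

/-- the kernel on words -/
def kk (c : α → A) : List (α × Bool) → List (α × Bool) → A
  | [], L' => wordVal c L'
  | a :: v, [] => star (wordVal c (a :: v))
  | a :: v, b :: v' => if a = b then kk c v v' else star (wordVal c (a :: v)) * wordVal c (b :: v')

theorem kk_eq (c : α → A) : ∀ (L L' : List (α × Bool)), FreeGroup.IsReduced L →
    FreeGroup.IsReduced L' → kk c L L' = wordVal c (FreeGroup.reduce (FreeGroup.invRev L ++ L')) := by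
  intro L
  induction L with
  | nil =>
    intro L' _ h'
    simp [kk, h'.reduce_eq]
  | cons a v ih =>
    intro L' h h'
    have hinv : FreeGroup.invRev (a :: v) = FreeGroup.invRev v ++ [(a.1, !a.2)] := by
      simp [FreeGroup.invRev]
    have hri : FreeGroup.IsReduced (FreeGroup.invRev (a :: v)) := by
      rw [FreeGroup.isReduced_iff_reduce_eq, FreeGroup.reduce_invRev, h.reduce_eq]
    cases L' with
    | nil =>
      rw [List.append_nil, hri.reduce_eq, wordVal_invRev, kk]
    | cons b v' =>
      rw [kk]
      split_ifs with hab
      · subst hab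
        rw [ih v' (List.IsChain.tail h) (List.IsChain.tail h')]
        congr 1
        rw [hinv]
        symm
        apply FreeGroup.reduce.Step.eq
        have := FreeGroup.Red.Step.not (L₁ := FreeGroup.invRev v) (L₂ := v') (x := a.1) (b := !a.2)
        simpa using this
      · have hr : FreeGroup.IsReduced (FreeGroup.invRev (a :: v) ++ (b :: v')) := by
          unfold FreeGroup.IsReduced at *
          rw [List.isChain_append]
          refine ⟨hri, h', ?_⟩
          rw [hinv]
          intro x hx y hy
          simp at hx hy
          subst hx; subst hy
          intro h1
          rcases a with ⟨a1, a2⟩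
          rcases b with ⟨b1, b2⟩
          simp only at h1 ⊢
          subst h1
          cases a2 <;> cases b2 <;> simp_all
        rw [hr.reduce_eq, wordVal_append, wordVal_invRev]

theorem haag_inv_mul (c : α → A) (v v' : FreeGroup α) :
    haag c (v⁻¹ * v') = kk c v.toWord v'.toWord := by
  rw [kk_eq c _ _ FreeGroup.isReduced_toWord FreeGroup.isReduced_toWord, haag,
    FreeGroup.toWord_mul, FreeGroup.toWord_inv]

theorem norm_lett (c : α → A) {ε : ℝ} (hc : ∀ t, ‖c t‖ ≤ ε) (x) : ‖lett c x‖ ≤ ε := by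
  rcases x with ⟨t, b⟩
  cases b <;> simp [lett, hc]

variable [PartialOrder A] [StarOrderedRing A]

theorem kk_diff_pos (c : α → A) (hc : ∀ t, ‖c t‖ ≤ 1) (m : ℕ) :
    KPos (fun v v' : {L : List (α × Bool) // L.length ≤ m} =>
      kk c v v' - star (wordVal c v) * wordVal c v') := by
  induction m with
  | zero =>
    intro n t z
    have : ∀ v : {L : List (α × Bool) // L.length ≤ 0}, v.1 = [] := fun v => by
      have := v.2; simpa using this
    simp [this, kk, wordVal_nil]
  | succ m ih =>
    let tl : {L : List (α × Bool) // L.length ≤ m + 1} → {L : List (α × Bool) // L.length ≤ m} :=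
      fun v => ⟨v.1.tail, by have := v.2; simp; omega⟩
    have hl : ∀ a : α × Bool, 0 ≤ 1 - star (lett c a) * lett c a := fun a => by
      rw [sub_nonneg]
      have h1 : ‖star (lett c a) * lett c a‖ ≤ 1 := by
        rw [CStarRing.norm_star_mul_self]
        have := norm_lett c hc a
        exact mul_le_one₀ this (norm_nonneg _) this
      exact (CStarAlgebra.norm_le_one_iff_of_nonneg _ (star_mul_self_nonneg _)).1 h1
    let k : Option (α × Bool) → {L : List (α × Bool) // L.length ≤ m + 1} →
      {L : List (α × Bool) // L.length ≤ m + 1} → A := fun o v v' => match o with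
        | none => 0
        | some a => (kk c (tl v) (tl v') - star (wordVal c (tl v)) * wordVal c (tl v'))
            + star (wordVal c (tl v)) * (1 - star (lett c a) * lett c a) * wordVal c (tl v')
    have hk : ∀ o, KPos (k o) := by
      intro o
      cases o with
      | none => intro n t z; simp [k]
      | some a => exact (ih.comp tl).add ((KPos.const (hl a)).const_mul fun v => wordVal c (tl v))
    refine (KPos.block (fun v => v.1.head?) k hk).congr ?_
    rintro ⟨L, hL⟩ ⟨L', hL'⟩
    cases L with
    | nil => cases L' <;> simp [kk, k, wordVal_nil]
    | cons a v =>
      cases L' with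
      | nil => simp [kk, wordVal_nil]
      | cons b v' =>
        by_cases hab : a = b
        · subst hab
          simp [kk, k, tl, wordVal_cons]
          noncomm_ring
        · simp [kk, hab]

theorem kk_pos (c : α → A) (hc : ∀ t, ‖c t‖ ≤ 1) : KPos (kk c) := by
  have h1 : KPos (fun v v' => kk c v v' - star (wordVal c v) * wordVal c v') := by
    intro n t z
    obtain ⟨m, hm⟩ : ∃ m, ∀ i, (t i).length ≤ m :=
      ⟨Finset.univ.sup fun i => (t i).length, fun i =>
        Finset.le_sup (f := fun i => (t i).length) (Finset.mem_univ i)⟩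
    exact kk_diff_pos c hc m n (fun i => ⟨t i, hm i⟩) z
  have h2 : KPos (fun v v' => star (wordVal c v) * (1 : A) * wordVal c v') :=
    (KPos.const zero_le_one).const_mul (wordVal c)
  refine (h1.add h2).congr fun i j => ?_
  simp

theorem haag_pos (c : α → A) (hc : ∀ t, ‖c t‖ ≤ 1) :
    KPos (fun v v' : FreeGroup α => haag c (v⁻¹ * v')) :=
  ((kk_pos c hc).comp FreeGroup.toWord).congr fun v v' => haag_inv_mul c v v'

end haag

section haag2
variable {α A : Type} [CStarAlgebra A] [DecidableEq α]

theorem haag_one (c : α → A) : haag c 1 = 1 := by simp [haag, wordVal]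
theorem haag_of (c : α → A) (t : α) : haag c (FreeGroup.of t) = c t := by
  simp [haag, wordVal, lett]
theorem haag_of_inv (c : α → A) (t : α) : haag c (FreeGroup.of t)⁻¹ = star (c t) := by
  rw [haag, FreeGroup.toWord_inv, wordVal_invRev]
  simp [wordVal, lett]

theorem norm_haag_le (c : α → A) {ε : ℝ} (hε : 0 ≤ ε) (hc : ∀ t, ‖c t‖ ≤ ε) (w : FreeGroup α) :
    ‖haag c w‖ ≤ ε ^ w.toWord.length := by
  unfold haag
  generalize w.toWord = L
  induction L with
  | nil =>
    rcases subsingleton_or_nontrivial A with h | h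
    · rw [Subsingleton.elim (wordVal c []) 0]; simp
    · simp [wordVal]
  | cons x L ih =>
    rw [wordVal_cons, List.length_cons, pow_succ']
    exact (norm_mul_le _ _).trans (mul_le_mul (norm_lett c hc x) ih (norm_nonneg _) hε)

theorem haag_neg (c : α → A) (w : FreeGroup α) :
    haag (fun t => - c t) w = (-1 : ℂ) ^ w.toWord.length • haag c w := by
  unfold haag
  generalize w.toWord = L
  induction L with
  | nil => simp [wordVal]
  | cons x L ih =>
    rw [wordVal_cons, ih, wordVal_cons, List.length_cons, pow_succ']
    have : lett (fun t => - c t) x = - lett c x := by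
      rcases x with ⟨t, b⟩
      cases b <;> simp [lett]
    rw [this]; simp

end haag2


open scoped ComplexOrder
section sidonform
open Finset

/-- matrix acting on vectors with entries in a module -/
def mv {N : ℕ} {H : Type} [AddCommGroup H] [Module ℂ H] (s : Matrix (Fin N) (Fin N) ℂ)
    (h : Fin N → H) : Fin N → H := fun c => ∑ b, s c b • h b

theorem mv_mul {N : ℕ} {H : Type} [AddCommGroup H] [Module ℂ H] (s t : Matrix (Fin N) (Fin N) ℂ)
    (h : Fin N → H) : mv (s * t) h = mv s (mv t h) := by
  funext c
  simp only [mv, Matrix.mul_apply, Finset.sum_smul, Finset.smul_sum, smul_smul]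
  rw [Finset.sum_comm]

theorem mv_one {N : ℕ} {H : Type} [AddCommGroup H] [Module ℂ H] 
    (h : Fin N → H) : mv 1 h = h := by
  funext c
  simp [mv, Matrix.one_apply]

variable {H : Type} [NormedAddCommGroup H] [InnerProductSpace ℂ H]

/-- form associated with a matrix and an operator -/
noncomputable def mform {N : ℕ} (m : Matrix (Fin N) (Fin N) ℂ) (v : H →L[ℂ] H) (h1 h2 : Fin N → H) : ℂ :=
  ∑ i, ∑ j, m i j * inner ℂ (h1 i) (v (h2 j))

theorem mform_conj {N : ℕ} (m p q : Matrix (Fin N) (Fin N) ℂ) (v : H →L[ℂ] H) (h1 h2 : Fin N → H) :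
    mform (p.conjTranspose * m * q) v h1 h2 = mform m v (mv p h1) (mv q h2) := by
  simp only [mform, mv, Matrix.mul_apply, sum_inner, inner_sum, map_sum, map_smul, inner_smul_left,
    inner_smul_right, Matrix.conjTranspose_apply, Finset.sum_mul, Finset.mul_sum]
  have h1 : ∀ F : Fin N → Fin N → Fin N → Fin N → ℂ,
     (∑ i, ∑ j, ∑ x, ∑ y, F i j x y) = ∑ y, ∑ x, ∑ i, ∑ j, F i j x y := by
    intro F
    calc (∑ i, ∑ j, ∑ x, ∑ y, F i j x y) = ∑ p : Fin N × Fin N × Fin N × Fin N, F p.1 p.2.1 p.2.2.1 p.2.2.2 := by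
          simp only [Fintype.sum_prod_type]
      _ = ∑ p : Fin N × Fin N × Fin N × Fin N, F p.2.2.1 p.2.2.2 p.2.1 p.1 :=
          Fintype.sum_equiv (⟨fun p => (p.2.2.2, p.2.2.1, p.1, p.2.1), fun p => (p.2.2.1, p.2.2.2, p.2.1, p.1),
            fun _ => rfl, fun _ => rfl⟩ : (Fin N × Fin N × Fin N × Fin N) ≃ (Fin N × Fin N × Fin N × Fin N))
            _ _ fun _ => rfl
      _ = _ := by simp only [Fintype.sum_prod_type]
  rw [h1]
  refine sum_congr rfl fun _ _ => sum_congr rfl fun _ _ => ?_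
  rw [Finset.sum_comm]
  refine sum_congr rfl fun _ _ => sum_congr rfl fun _ _ => ?_
  simp; ring

variable {G : Type} {Λ : Set G}

theorem inner_sidonOp {N : ℕ} (a : ↥Λ →₀ Matrix (Fin N) (Fin N) ℂ) (v : ↥Λ → H →L[ℂ] H)
    (h1 h2 : PiLp 2 (fun _ : Fin N => H)) :
    inner ℂ h1 (sidonOp a v h2) = a.sum fun t m => mform m (v t) h1 h2 := by
  rw [PiLp.inner_apply]
  simp only [sidonOp, ContinuousLinearMap.comp_apply, ContinuousLinearEquiv.coe_coe]
  simp [mform, inner_sum, inner_smul_right, Finsupp.sum, _root_.sum_apply]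
  rw [Finset.sum_comm]

/-- quadratic form -/
noncomputable def qf {N : ℕ} (m : Matrix (Fin N) (Fin N) ℂ) (h : Fin N → H) : ℝ :=
  (mform m (ContinuousLinearMap.id ℂ H) h h).re

theorem mform_add {N : ℕ} (m m' : Matrix (Fin N) (Fin N) ℂ) (v : H →L[ℂ] H) (h1 h2 : Fin N → H) :
    mform (m + m') v h1 h2 = mform m v h1 h2 + mform m' v h1 h2 := by
  simp [mform, add_mul, Finset.sum_add_distrib]

theorem qf_smul {N : ℕ} (r : ℝ) (m : Matrix (Fin N) (Fin N) ℂ) (h : Fin N → H) :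
    qf ((r : ℂ) • m) h = r * qf m h := by
  simp only [qf, mform, Matrix.smul_apply, smul_eq_mul, mul_assoc, ← Finset.mul_sum]
  simp

theorem qf_add {N : ℕ} (m m' : Matrix (Fin N) (Fin N) ℂ) (h : Fin N → H) :
    qf (m + m') h = qf m h + qf m' h := by
  simp [qf, mform_add]

theorem qf_one {N : ℕ} (h : Fin N → H) : qf 1 h = ∑ a, ‖h a‖ ^ 2 := by
  simp only [qf, mform, Matrix.one_apply]
  simp
  refine sum_congr rfl fun i _ => ?_
  have := inner_self_eq_norm_sq (𝕜 := ℂ) (h i)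
  simpa using this

theorem qf_star {N : ℕ} (m : Matrix (Fin N) (Fin N) ℂ) (h : Fin N → H) :
    qf m.conjTranspose h = qf m h := by
  simp only [qf, mform, Complex.re_sum]
  rw [Finset.sum_comm]
  refine sum_congr rfl fun i _ => sum_congr rfl fun j _ => ?_
  show (star (m i j) * inner ℂ (h j) (h i)).re = (m i j * inner ℂ (h i) (h j)).re
  rw [← inner_conj_symm (h j) (h i)]
  generalize inner ℂ (h i) (h j) = q
  simp

theorem qf_sq {N : ℕ} (s : Matrix (Fin N) (Fin N) ℂ) (h : Fin N → H) :
    qf (s.conjTranspose * s) h = ∑ c, ‖mv s h c‖ ^ 2 := by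
  rw [← qf_one, qf, qf, ← mform_conj]
  simp

theorem exists_sq {N : ℕ} (M : Matrix (Fin N) (Fin N) ℂ) (hM : ∀ z : Fin N → ℂ, 0 ≤ qf M z)
    {δ : ℝ} (hδ : 0 < δ) : ∃ s s' : Matrix (Fin N) (Fin N) ℂ, s * s' = 1 ∧ s' * s = 1 ∧
      ∀ (H : Type) [NormedAddCommGroup H] [InnerProductSpace ℂ H] (h : Fin N → H),
        qf M h + δ * ∑ a, ‖h a‖ ^ 2 = ∑ c, ‖mv s h c‖ ^ 2 := by
  set M' : Matrix (Fin N) (Fin N) ℂ := ((1/2 : ℝ) : ℂ) • (M + M.conjTranspose) + ((δ : ℝ) : ℂ) • 1 with hM'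
  have hq : ∀ (H : Type) [NormedAddCommGroup H] [InnerProductSpace ℂ H] (h : Fin N → H),
      qf M' h = qf M h + δ * ∑ a, ‖h a‖ ^ 2 := by
    intro H _ _ h
    rw [hM', qf_add, qf_smul, qf_smul, qf_add, qf_star, qf_one]; ring
  have hherm : M'.IsHermitian := by
    rw [hM']
    unfold Matrix.IsHermitian
    simp [Matrix.conjTranspose_add, Matrix.conjTranspose_smul, add_comm]
  have hre : ∀ z : Fin N → ℂ, (star z ⬝ᵥ Matrix.mulVec M' z).re = qf M' z := by
    intro z
    simp only [qf, mform, dotProduct, Matrix.mulVec, Finset.mul_sum]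
    congr 1
    refine sum_congr rfl fun i _ => sum_congr rfl fun j _ => ?_
    simp; ring
  open scoped ComplexOrder in
  have hpd : M'.PosDef := by
    refine Matrix.PosDef.of_dotProduct_mulVec_pos hherm fun z hz => ?_
    rw [Complex.lt_def]
    refine ⟨?_, ?_⟩
    · rw [hre, hq]
      have : 0 < ∑ a, ‖z a‖ ^ 2 := by
        obtain ⟨i, hi⟩ := Function.ne_iff.1 hz
        refine Finset.sum_pos' (fun _ _ => sq_nonneg _) ⟨i, mem_univ _, ?_⟩
        have : z i ≠ 0 := hi
        positivity
      have := hM z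
      simp only [Complex.zero_re]
      positivity
    · have := hherm.im_star_dotProduct_mulVec_self z
      simpa using this.symm
  obtain ⟨s, hs⟩ : ∃ B : Matrix (Fin N) (Fin N) ℂ, M' = B.conjTranspose * B := by
    open scoped MatrixOrder Matrix.Norms.L2Operator ComplexOrder in
    exact CStarAlgebra.nonneg_iff_eq_star_mul_self.mp hpd.posSemidef.nonneg
  have hdet : IsUnit s.det := by
    open scoped ComplexOrder in
    have h1 : M'.det ≠ 0 := hpd.det_pos.ne'
    rw [hs, Matrix.det_mul] at h1
    exact (right_ne_zero_of_mul h1).isUnit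
  refine ⟨s, s⁻¹, Matrix.mul_nonsing_inv s hdet, Matrix.nonsing_inv_mul s hdet, ?_⟩
  intro H _ _ h
  rw [← hq, hs, qf_sq]

theorem opNorm_le_two {E : Type} [NormedAddCommGroup E] [InnerProductSpace ℂ E] (T : E →L[ℂ] E)
    (h : ∀ x y, 0 ≤ ‖x‖ ^ 2 + ‖y‖ ^ 2 + (inner ℂ x (T y)).re) : ‖T‖ ≤ 2 := by
  refine T.opNorm_le_bound (by norm_num) fun y => ?_
  by_cases hT : T y = 0
  · rw [hT]; simp
  have hpos : 0 < ‖T y‖ := norm_pos_iff.2 hT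
  have := h (((-(‖y‖ / ‖T y‖) : ℝ) : ℂ) • T y) y
  rw [inner_smul_left, norm_smul, Complex.conj_ofReal, Complex.re_ofReal_mul] at this
  have h2 : (inner ℂ (T y) (T y)).re = ‖T y‖ ^ 2 := inner_self_eq_norm_sq (𝕜 := ℂ) (T y)
  rw [h2, Complex.norm_real, norm_neg, Real.norm_of_nonneg (by positivity)] at this
  have e1 : ‖y‖ / ‖T y‖ * ‖T y‖ = ‖y‖ := by field_simp
  have e2 : -(‖y‖ / ‖T y‖) * ‖T y‖ ^ 2 = - (‖y‖ * ‖T y‖) := by field_simp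
  rw [e1, e2] at this
  by_cases hy : ‖y‖ = 0
  · exfalso; apply hT; rw [norm_eq_zero.1 hy]; simp
  · have hy' : 0 < ‖y‖ := lt_of_le_of_ne (norm_nonneg _) (Ne.symm hy)
    nlinarith

/-- Sidon property in terms of forms. -/
theorem sidon_form [Group G] {C : ℝ} (hΛ : IsCompletelySidon Λ C) {N : ℕ}
    (a : ↥Λ →₀ Matrix (Fin N) (Fin N) ℂ) (P Q : Matrix (Fin N) (Fin N) ℂ)
    (h : ∀ (H : Type) [NormedAddCommGroup H] [InnerProductSpace ℂ H] [CompleteSpace H]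
      (π : G →* unitary (H →L[ℂ] H)) (h1 h2 : Fin N → H),
      0 ≤ qf P h1 + qf Q h2 + (a.sum fun t m => mform m (π (t : G) : H →L[ℂ] H) h1 h2).re)
    (K : Type) [NormedAddCommGroup K] [InnerProductSpace ℂ K] [CompleteSpace K]
    (u : ↥Λ → unitary (K →L[ℂ] K)) (k1 k2 : Fin N → K) :
    0 ≤ C * qf P k1 + C * qf Q k2 + (a.sum fun t m => mform m (u t : K →L[ℂ] K) k1 k2).re := by
  have hP : ∀ z : Fin N → ℂ, 0 ≤ qf P z := fun z => by
    have := h ℂ 1 z 0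
    simpa [qf, mform] using this
  have hQ : ∀ z : Fin N → ℂ, 0 ≤ qf Q z := fun z => by
    have := h ℂ 1 0 z
    simpa [qf, mform] using this
  have main : ∀ δ : ℝ, 0 < δ → 0 ≤ C * (qf P k1 + δ * ∑ a, ‖k1 a‖ ^ 2)
      + C * (qf Q k2 + δ * ∑ a, ‖k2 a‖ ^ 2)
      + (a.sum fun t m => mform m (u t : K →L[ℂ] K) k1 k2).re := by
    intro δ hδ
    obtain ⟨s, s', hss, hss', hs⟩ := exists_sq P hP hδ
    obtain ⟨r, r', hrr, hrr', hr⟩ := exists_sq Q hQ hδ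
    let k : ↥Λ →₀ Matrix (Fin N) (Fin N) ℂ :=
      a.mapRange (fun m => s'.conjTranspose * m * r') (by simp)
    have hk : ∀ (H : Type) [NormedAddCommGroup H] [InnerProductSpace ℂ H] (v : ↥Λ → H →L[ℂ] H)
        (h1 h2 : PiLp 2 (fun _ : Fin N => H)),
        inner ℂ h1 (sidonOp k v h2) = a.sum fun t m => mform m (v t) (mv s' h1) (mv r' h2) := by
      intro H _ _ v h1 h2
      rw [inner_sidonOp, Finsupp.sum_mapRange_index (by simp [mform])]
      simp only [mform_conj]
    have h1 := hΛ N k 2 (by norm_num) (by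
      intro H _ _ _ π
      refine opNorm_le_two _ fun x y => ?_
      rw [hk]
      have h2 := h H π (mv s' x) (mv r' y)
      have e1 := hs H (mv s' x)
      have e2 := hr H (mv r' y)
      rw [← mv_mul, hss, mv_one] at e1
      rw [← mv_mul, hrr, mv_one] at e2
      rw [PiLp.norm_sq_eq_of_L2, PiLp.norm_sq_eq_of_L2, ← e1, ← e2]
      have : 0 ≤ δ * ∑ a, ‖mv s' x a‖ ^ 2 := by positivity
      have : 0 ≤ δ * ∑ a, ‖mv r' y a‖ ^ 2 := by positivity
      linarith) K u
    have hC : 0 ≤ C := by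
      have := (norm_nonneg _).trans h1
      linarith
    let x : PiLp 2 (fun _ : Fin N => K) := WithLp.toLp 2 (mv s k1)
    let y : PiLp 2 (fun _ : Fin N => K) := WithLp.toLp 2 (mv r k2)
    have h3 := hk K (fun t => (u t : K →L[ℂ] K)) x y
    have ex : mv s' x = k1 := by
      show mv s' (mv s k1) = k1
      rw [← mv_mul, hss', mv_one]
    have ey : mv r' y = k2 := by
      show mv r' (mv r k2) = k2
      rw [← mv_mul, hrr', mv_one]
    rw [ex, ey] at h3
    rw [← h3, hs, hr]
    have nx : ‖x‖ ^ 2 = ∑ c, ‖mv s k1 c‖ ^ 2 := PiLp.norm_sq_eq_of_L2 _ x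
    have ny : ‖y‖ ^ 2 = ∑ c, ‖mv r k2 c‖ ^ 2 := PiLp.norm_sq_eq_of_L2 _ y
    rw [← nx, ← ny]
    set T := sidonOp k (fun t => (u t : K →L[ℂ] K))
    have h4 : |(inner ℂ x (T y)).re| ≤ ‖x‖ * (C * 2 * ‖y‖) :=
      (Complex.abs_re_le_norm _).trans ((norm_inner_le_norm _ _).trans
        (mul_le_mul_of_nonneg_left ((T.le_opNorm y).trans
          (mul_le_mul_of_nonneg_right h1 (norm_nonneg _))) (norm_nonneg _)))
    have h5 := (abs_le.1 h4).1
    nlinarith [mul_nonneg hC (sq_nonneg (‖x‖ - ‖y‖))]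
  have hlim : Filter.Tendsto (fun δ : ℝ => C * (qf P k1 + δ * ∑ a, ‖k1 a‖ ^ 2)
      + C * (qf Q k2 + δ * ∑ a, ‖k2 a‖ ^ 2)
      + (a.sum fun t m => mform m (u t : K →L[ℂ] K) k1 k2).re) (nhdsWithin 0 (Set.Ioi 0))
      (nhds (C * (qf P k1 + 0 * ∑ a, ‖k1 a‖ ^ 2)
      + C * (qf Q k2 + 0 * ∑ a, ‖k2 a‖ ^ 2)
      + (a.sum fun t m => mform m (u t : K →L[ℂ] K) k1 k2).re)) := by
    apply Filter.Tendsto.mono_left _ nhdsWithin_le_nhds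
    apply Continuous.tendsto' _ _ _ rfl
    fun_prop
  have := ge_of_tendsto hlim (eventually_nhdsWithin_of_forall fun δ hδ => main δ hδ)
  simpa using this

end sidonform


open scoped ComplexOrder
section riesz
open Finset

/-- positive definiteness of a two-by-two block function on a group -/
def PD2 {F : Type} [Group F] (X : Fin 2 × Fin 2 × F → ℂ) : Prop :=
  KPos (fun a b : Fin 2 × F => X (a.1, b.1, a.2⁻¹ * b.2))

theorem KPos.norm_le {ι : Type} {k : ι → ι → ℂ} (hk : KPos k) (a b : ι) :
    ‖k a b‖ ≤ (k a a).re + (k b b).re := by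
  obtain ⟨R, _, _, _, v, hv⟩ := hk.kolmogorov
  rw [← hv, ← hv, ← hv]
  have h1 : (inner ℂ (v a) (v a)).re = ‖v a‖ ^ 2 := inner_self_eq_norm_sq (𝕜 := ℂ) (v a)
  have h2 : (inner ℂ (v b) (v b)).re = ‖v b‖ ^ 2 := inner_self_eq_norm_sq (𝕜 := ℂ) (v b)
  rw [h1, h2]
  have := norm_inner_le_norm (𝕜 := ℂ) (v a) (v b)
  nlinarith [sq_nonneg (‖v a‖ - ‖v b‖), norm_nonneg (v a), norm_nonneg (v b)]

theorem PD2.norm_le {F : Type} [Group F] {X : Fin 2 × Fin 2 × F → ℂ} (hX : PD2 X)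
    (p : Fin 2 × Fin 2 × F) : ‖X p‖ ≤ 2 * ((X (0, 0, 1)).re + (X (1, 1, 1)).re) := by
  have h1 := KPos.norm_le hX (p.1, 1) (p.2.1, p.2.2)
  simp only [inv_one, one_mul, inv_mul_cancel] at h1
  have h0 : 0 ≤ (X (0, 0, 1)).re := by
    have := (norm_nonneg _).trans (KPos.norm_le hX (0, 1) (0, 1))
    simp only [inv_one, one_mul] at this; linarith
  have h0' : 0 ≤ (X (1, 1, 1)).re := by
    have := (norm_nonneg _).trans (KPos.norm_le hX (1, 1) (1, 1))
    simp only [inv_one, one_mul] at this; linarith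
  have h2 : ∀ i : Fin 2, (X (i, i, 1)).re ≤ (X (0, 0, 1)).re + (X (1, 1, 1)).re := by
    intro i; fin_cases i <;> simp <;> assumption
  have e : X p = X (p.1, p.2.1, p.2.2) := rfl
  rw [e]
  linarith [h2 p.1, h2 p.2.1]

/-- pairing of a finitely supported function with a function -/
noncomputable def lc {ι : Type} (X : ι → ℂ) : (ι →₀ ℂ) →ₗ[ℂ] ℂ := Finsupp.linearCombination ℂ X

theorem lc_apply {ι : Type} (X : ι → ℂ) (e : ι →₀ ℂ) : lc X e = ∑ p ∈ e.support, e p * X p := by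
  simp [lc, Finsupp.linearCombination_apply, Finsupp.sum]

theorem lc_single {ι : Type} (X : ι → ℂ) (p : ι) (c : ℂ) : lc X (Finsupp.single p c) = c * X p := by
  simp [lc]

theorem exists_PD2 {F : Type} [Group F] (T : Set (Fin 2 × Fin 2 × F))
    (hT0 : ((0 : Fin 2), (0 : Fin 2), (1 : F)) ∈ T) (hT1 : ((1 : Fin 2), (1 : Fin 2), (1 : F)) ∈ T)
    (X0 : Fin 2 × Fin 2 × F → ℂ)
    (h : ∀ e : (Fin 2 × Fin 2 × F) →₀ ℂ, (∀ p, p ∉ T → e p = 0) →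
      (∀ X, PD2 X → 0 ≤ (lc X e).re) → 0 ≤ (lc X0 e).re) :
    ∃ x, PD2 x ∧ ∀ p ∈ T, x p = X0 p := by
  let P : PointedCone ℝ ((Fin 2 × Fin 2 × F) →₀ ℂ) :=
    { carrier := {e | ∀ X, PD2 X → 0 ≤ (lc X e).re}
      add_mem' := by
        intro a b ha hb X hX
        rw [map_add, Complex.add_re]; exact add_nonneg (ha X hX) (hb X hX)
      zero_mem' := by intro X _; simp
      smul_mem' := by
        intro r a ha X hX
        have e : r • a = ((r : ℝ) : ℂ) • a := by ext p; simp [NNReal.smul_def]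
        rw [e, map_smul, smul_eq_mul, Complex.re_ofReal_mul]
        exact mul_nonneg r.2 (ha X hX) }
  let S : Submodule ℝ ((Fin 2 × Fin 2 × F) →₀ ℂ) :=
    { carrier := {e | ∀ p, p ∉ T → e p = 0}
      add_mem' := by intro a b ha hb p hp; simp [ha p hp, hb p hp]
      zero_mem' := by intro p _; simp
      smul_mem' := by intro r a ha p hp; simp [ha p hp] }
  let f0 : ((Fin 2 × Fin 2 × F) →₀ ℂ) →ₗ[ℝ] ℝ :=
    { toFun := fun e => (lc X0 e).re
      map_add' := by intro a b; simp
      map_smul' := by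
        intro r a
        have e : r • a = (r : ℂ) • a := by ext p; simp
        rw [e, map_smul]; simp }
  obtain ⟨g, hg1, hg2⟩ := riesz_extension P (f0.toPMap S) (by
      intro e he; exact h e e.2 he) (by
      intro y
      let c : ℝ := 2 * ∑ p ∈ y.support, ‖y p‖
      refine ⟨⟨Finsupp.single (0, 0, 1) (c : ℂ) + Finsupp.single (1, 1, 1) (c : ℂ), ?_⟩, ?_⟩
      · intro p hp
        have h0 : ((0 : Fin 2), (0 : Fin 2), (1 : F)) ≠ p := fun h => hp (h ▸ hT0)
        have h1 : ((1 : Fin 2), (1 : Fin 2), (1 : F)) ≠ p := fun h => hp (h ▸ hT1)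
        rw [Finsupp.add_apply, Finsupp.single_eq_of_ne h0.symm, Finsupp.single_eq_of_ne h1.symm, add_zero]
      · intro X hX
        simp only [map_add, lc_single, Complex.add_re, Complex.re_ofReal_mul]
        have : ‖lc X y‖ ≤ c * ((X (0, 0, 1)).re + (X (1, 1, 1)).re) := by
          rw [lc_apply]
          refine (norm_sum_le _ _).trans ?_
          simp only [c, mul_sum, sum_mul]
          refine sum_le_sum fun p _ => ?_
          rw [norm_mul]
          have := mul_le_mul_of_nonneg_left (hX.norm_le p) (norm_nonneg (y p))
          linarith
        have h2 := (abs_le.1 ((Complex.abs_re_le_norm (lc X y)).trans this)).1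
        linarith)
  let x : Fin 2 × Fin 2 × F → ℂ := fun p =>
    (g (Finsupp.single p 1) : ℂ) - Complex.I * g (Finsupp.single p Complex.I)
  have hgx : ∀ e, g e = (lc x e).re := by
    intro e
    induction e using Finsupp.induction_linear with
    | zero => simp
    | add a b ha hb => simp [ha, hb]
    | single p c =>
      have e1 : Finsupp.single p c = c.re • Finsupp.single p (1 : ℂ) + c.im • Finsupp.single p Complex.I := by
        rw [Finsupp.smul_single, Finsupp.smul_single, ← Finsupp.single_add]
        congr 1
        apply Complex.ext <;> simp
      rw [lc_single]
      rw [e1, map_add, map_smul, map_smul]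
      simp [x]
  refine ⟨x, ?_, ?_⟩
  · intro n t z
    let e : (Fin 2 × Fin 2 × F) →₀ ℂ := ∑ i, ∑ j,
      Finsupp.single ((t i).1, (t j).1, (t i).2⁻¹ * (t j).2) (star (z i) * z j)
    have he : ∀ X : Fin 2 × Fin 2 × F → ℂ, lc X e = ∑ i, ∑ j, star (z i) * X ((t i).1, (t j).1, (t i).2⁻¹ * (t j).2) * z j := by
      intro X
      simp only [e, map_sum, lc_single]
      refine sum_congr rfl fun i _ => sum_congr rfl fun j _ => ?_
      ring
    rw [← he]
    have hpos : ∀ X, PD2 X → 0 ≤ lc X e := fun X hX => by rw [he]; exact hX n t z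
    have a1 := hg2 e (fun X hX => (Complex.le_def.1 (hpos X hX)).1)
    have a2 := hg2 (Complex.I • e) (fun X hX => by
      have := (Complex.le_def.1 (hpos X hX)).2
      rw [map_smul]; simp at this ⊢; rw [← this]; )
    have a3 := hg2 (-Complex.I • e) (fun X hX => by
      have := (Complex.le_def.1 (hpos X hX)).2
      rw [map_smul]; simp at this ⊢; rw [← this]; )
    rw [hgx] at a1 a2 a3
    rw [map_smul] at a2 a3
    simp at a2 a3
    rw [Complex.le_def]
    exact ⟨a1, by simp; linarith⟩
  · intro p hp
    have hs : ∀ c : ℂ, g (Finsupp.single p c) = (c * X0 p).re := by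
      intro c
      rw [← lc_single]
      refine hg1 ⟨Finsupp.single p c, ?_⟩
      intro q hq
      have : p ≠ q := fun h => hq (h ▸ hp)
      exact Finsupp.single_eq_of_ne this.symm
    simp only [x, hs]
    apply Complex.ext <;> simp
end riesz


open scoped ComplexOrder
section sidonpd
open Finset

/-- permutation matrix -/
def pmat {n : ℕ} (s : Equiv.Perm (Fin n)) : Matrix (Fin n) (Fin n) ℂ :=
  fun a b => if s b = a then 1 else 0

theorem mform_pmat {n : ℕ} {H : Type} [NormedAddCommGroup H] [InnerProductSpace ℂ H]
    (s : Equiv.Perm (Fin n)) (v : H →L[ℂ] H) (h1 h2 : Fin n → H) :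
    mform (pmat s) v h1 h2 = ∑ b, inner ℂ (h1 (s b)) (v (h2 b)) := by
  simp only [mform, pmat]
  rw [Finset.sum_comm]
  refine sum_congr rfl fun b _ => ?_
  simp

theorem mform_zero {n : ℕ} {H : Type} [NormedAddCommGroup H] [InnerProductSpace ℂ H]
    (v : H →L[ℂ] H) (h1 h2 : Fin n → H) :
    mform 0 v h1 h2 = 0 := by simp [mform]

theorem mform_smul {n : ℕ} {H : Type} [NormedAddCommGroup H] [InnerProductSpace ℂ H]
    (c : ℂ) (m : Matrix (Fin n) (Fin n) ℂ) (v : H →L[ℂ] H) (h1 h2 : Fin n → H) :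
    mform (c • m) v h1 h2 = c * mform m v h1 h2 := by
  simp [mform, mul_sum, mul_assoc]

theorem mform_sum {n : ℕ} {H ι : Type} [NormedAddCommGroup H] [InnerProductSpace ℂ H]
    (s : Finset ι) (m : ι → Matrix (Fin n) (Fin n) ℂ) (v : H →L[ℂ] H) (h1 h2 : Fin n → H) :
    mform (∑ p ∈ s, m p) v h1 h2 = ∑ p ∈ s, mform (m p) v h1 h2 := by
  classical
  induction s using Finset.induction_on with
  | empty => simp [mform_zero]
  | insert a s ha ih => rw [sum_insert ha, sum_insert ha, mform_add, ih]

variable {G : Type} [Group G] {Λ : Set G}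

/-- the canonical map from the free group on `Λ` to `G` -/
def rho (Λ : Set G) : FreeGroup ↥Λ →* G := FreeGroup.lift (fun t : ↥Λ => (t : G))

theorem rho_of (t : ↥Λ) : rho Λ (FreeGroup.of t) = (t : G) := by simp [rho]

/-- support set -/
def goodT (Λ : Set G) : Set (Fin 2 × Fin 2 × FreeGroup ↥Λ) :=
  {p | (p.1 = p.2.1 ∧ rho Λ p.2.2 = 1) ∨ (p.1 = 0 ∧ p.2.1 = 1 ∧ rho Λ p.2.2 ∈ Λ)}

open Classical in
/-- prescribed values -/
noncomputable def X0 (Λ : Set G) (C : ℝ) (p : Fin 2 × Fin 2 × FreeGroup ↥Λ) : ℂ :=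
  if p.1 = p.2.1 then (if p.2.2 = 1 then (C : ℂ) else 0)
  else if ∃ t : ↥Λ, p.2.2 = FreeGroup.of t then 1 else 0

theorem PD2_pmat {n : ℕ} (σ : FreeGroup ↥Λ →* Equiv.Perm (Fin n)) {H : Type} [NormedAddCommGroup H]
    [InnerProductSpace ℂ H] [CompleteSpace H] (π : G →* unitary (H →L[ℂ] H)) (h : Fin 2 → Fin n → H) :
    PD2 (fun p : Fin 2 × Fin 2 × FreeGroup ↥Λ =>
      mform (pmat (σ p.2.2)) (π (rho Λ p.2.2) : H →L[ℂ] H) (h p.1) (h p.2.1)) := by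
  let η : Fin 2 × FreeGroup ↥Λ → PiLp 2 (fun _ : Fin n => H) := fun q =>
    WithLp.toLp 2 (fun b => (π (rho Λ q.2) : H →L[ℂ] H) (h q.1 ((σ q.2)⁻¹ b)))
  refine (KPos.gram η).congr fun q r => ?_
  simp only [mform_pmat, PiLp.inner_apply, η]
  refine Fintype.sum_equiv (σ r.2) _ _ fun b => ?_
  have e1 : (σ r.2)⁻¹ ((σ r.2) b) = b := (σ r.2).symm_apply_apply b
  simp only [map_mul, map_inv, Equiv.Perm.mul_apply, e1]
  have e2 : ∀ (u v : unitary (H →L[ℂ] H)) (x y : H),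
      inner ℂ x (((u⁻¹ * v : unitary (H →L[ℂ] H)) : H →L[ℂ] H) y)
        = inner ℂ ((u : H →L[ℂ] H) x) ((v : H →L[ℂ] H) y) := by
    intro u v x y
    rw [← ContinuousLinearMap.adjoint_inner_right]
    rfl
  exact e2 _ _ _ _

open Classical in
/-- the terms in the Sidon form -/
noncomputable def sterm {n : ℕ} (σ : FreeGroup ↥Λ →* Equiv.Perm (Fin n)) (c : ℝ) {H : Type} [NormedAddCommGroup H]
    [InnerProductSpace ℂ H] (v : ↥Λ → H →L[ℂ] H) (h1 h2 : Fin n → H) (p : Fin 2 × Fin 2 × FreeGroup ↥Λ) : ℂ :=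
  if p.1 = 0 ∧ p.2.1 = 0 then c * mform (pmat (σ p.2.2)) (ContinuousLinearMap.id ℂ H) h1 h1
  else if p.1 = 1 ∧ p.2.1 = 1 then c * mform (pmat (σ p.2.2)) (ContinuousLinearMap.id ℂ H) h2 h2
  else if h : rho Λ p.2.2 ∈ Λ then mform (pmat (σ p.2.2)) (v ⟨_, h⟩) h1 h2 else 0

theorem exists_forms {n : ℕ} (σ : FreeGroup ↥Λ →* Equiv.Perm (Fin n)) (e : (Fin 2 × Fin 2 × FreeGroup ↥Λ) →₀ ℂ) :
    ∃ (P Q : Matrix (Fin n) (Fin n) ℂ) (a : ↥Λ →₀ Matrix (Fin n) (Fin n) ℂ),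
    ∀ (c : ℝ) (H : Type) [NormedAddCommGroup H] [InnerProductSpace ℂ H] (v : ↥Λ → H →L[ℂ] H) (h1 h2 : Fin n → H),
      c * qf P h1 + c * qf Q h2 + (a.sum fun t m => mform m (v t) h1 h2).re
        = (∑ p ∈ e.support, e p * sterm σ c v h1 h2 p).re := by
  classical
  refine ⟨∑ p ∈ e.support, if p.1 = 0 ∧ p.2.1 = 0 then e p • pmat (σ p.2.2) else 0,
    ∑ p ∈ e.support, if p.1 = 0 ∧ p.2.1 = 0 then 0 else if p.1 = 1 ∧ p.2.1 = 1 then e p • pmat (σ p.2.2) else 0,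
    ∑ p ∈ e.support, if p.1 = 0 ∧ p.2.1 = 0 then 0 else if p.1 = 1 ∧ p.2.1 = 1 then 0
      else if h : rho Λ p.2.2 ∈ Λ then Finsupp.single ⟨_, h⟩ (e p • pmat (σ p.2.2)) else 0, ?_⟩
  intro c H _ _ v h1 h2
  rw [← Finsupp.sum_finsetSum_index (h := fun t m => mform m (v t) h1 h2) (by simp [mform_zero]) (by simp [mform_add])]
  simp only [qf, mform_sum]
  rw [← Complex.re_ofReal_mul, ← Complex.re_ofReal_mul, ← Complex.add_re, ← Complex.add_re]
  congr 1
  rw [mul_sum, mul_sum, ← sum_add_distrib, ← sum_add_distrib]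
  refine sum_congr rfl fun p _ => ?_
  unfold sterm
  split_ifs with a1 a2 a3
  · simp [mform_zero, mform_smul]; ring
  · simp [mform_zero, mform_smul]; ring
  · rw [Finsupp.sum_single_index (by simp [mform_zero])]
    simp [mform_zero, mform_smul]
  · simp [mform_zero]

theorem inner_single_single {n : ℕ} (a b : Fin n) :
    inner ℂ (EuclideanSpace.single a (1 : ℂ)) (EuclideanSpace.single b (1 : ℂ)) = if a = b then (1 : ℂ) else 0 := by
  rw [EuclideanSpace.inner_single_left]
  simp [Pi.single_apply]

theorem sidon_PD2 {C : ℝ} (hΛ : IsCompletelySidon Λ C) : ∃ x : Fin 2 × Fin 2 × FreeGroup ↥Λ → ℂ,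
    PD2 x ∧ ∀ p ∈ goodT Λ, x p = X0 Λ C p := by
  classical
  refine exists_PD2 _ (by simp [goodT]) (by simp [goodT]) _ fun e he hX => ?_
  let τ : FreeGroup ↥Λ → FreeGroup ↥Λ := fun w =>
    if h : rho Λ w ∈ Λ then w * (FreeGroup.of (⟨_, h⟩ : ↥Λ))⁻¹ else 1
  obtain ⟨n, σ, hn, hσ⟩ := freeGroup_sep
    ((e.support.image fun p => p.2.2) ∪ (e.support.image fun p => τ p.2.2))
  obtain ⟨P, Q, a, hPQ⟩ := exists_forms σ e
  have hT : ∀ p ∈ e.support, p ∈ goodT Λ := fun p hp => by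
    by_contra h
    exact Finsupp.mem_support_iff.1 hp (he p h)
  have key := sidon_form hΛ a P Q (by
    intro H _ _ _ π h1 h2
    have := hPQ 1 H (fun t => (π (t : G) : H →L[ℂ] H)) h1 h2
    rw [one_mul, one_mul] at this
    rw [this]
    have h3 := hX _ (PD2_pmat σ π ![h1, h2])
    rw [lc_apply] at h3
    refine h3.trans_eq ?_
    congr 1
    refine sum_congr rfl fun p hp => ?_
    congr 1
    obtain ⟨i, j, w⟩ := p
    have hp' := hT _ hp
    unfold sterm
    rcases hp' with ⟨hij, hw⟩ | ⟨hi, hj, hw⟩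
    · simp only at hij hw
      subst hij
      have e1 : ((π (rho Λ w) : unitary (H →L[ℂ] H)) : H →L[ℂ] H) = ContinuousLinearMap.id ℂ H := by
        rw [hw, map_one]; rfl
      simp only [e1]
      fin_cases i <;> simp
    · simp only at hi hj hw
      subst hi hj
      simp [hw]) (EuclideanSpace ℂ (Fin n))
    (fun t => Unitary.linearIsometryEquiv.symm (LinearIsometryEquiv.piLpCongrLeft 2 ℂ ℂ (σ (FreeGroup.of t))))
    (fun b => EuclideanSpace.single b 1) (fun b => EuclideanSpace.single b 1)
  rw [hPQ] at key
  have hfin : (n : ℝ) * (lc (X0 Λ C) e).re = (∑ p ∈ e.support, e p * sterm σ C (fun t => (Unitary.linearIsometryEquiv.symm (LinearIsometryEquiv.piLpCongrLeft 2 ℂ ℂ (σ (FreeGroup.of t))) : EuclideanSpace ℂ (Fin n) →L[ℂ] EuclideanSpace ℂ (Fin n)))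
      (fun b => EuclideanSpace.single b 1) (fun b => EuclideanSpace.single b 1) p).re := by
    rw [lc_apply, ← Complex.re_ofReal_mul, mul_sum]
    congr 1
    refine sum_congr rfl fun p hp => ?_
    rw [mul_left_comm]
    congr 1
    have hs1 : p.2.2 ≠ 1 → ∀ a, σ p.2.2 a ≠ a := hσ _ (mem_union_left _ (mem_image_of_mem _ hp))
    have hs2 : τ p.2.2 ≠ 1 → ∀ a, σ (τ p.2.2) a ≠ a := hσ _ (mem_union_right _ (mem_image_of_mem _ hp))
    have hp' := hT _ hp
    obtain ⟨i, j, w⟩ := p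
    have hdiag : (∑ b : Fin n, inner ℂ (EuclideanSpace.single (σ w b) (1 : ℂ)) (EuclideanSpace.single b (1:ℂ))) = if w = 1 then (n : ℂ) else 0 := by
      split_ifs with h1
      · subst h1; simp
      · refine sum_eq_zero fun b _ => ?_
        have := hs1 h1 b
        rw [inner_single_single, if_neg this]
    unfold sterm X0
    rcases hp' with ⟨hij, hw⟩ | ⟨hi, hj, hw⟩
    · simp only at hij hw
      subst hij
      simp only [mform_pmat, ContinuousLinearMap.id_apply, hdiag]
      fin_cases i
      · simp
        split_ifs <;> simp [mul_comm]
      · simp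
        split_ifs <;> simp [mul_comm]
    · simp only at hi hj hw
      subst hi hj
      simp [hw, mform_pmat]
      have h2 : ∀ x, inner ℂ (EuclideanSpace.single ((σ w) x) (1 : ℂ))
          (PiLp.single 2 ((σ (FreeGroup.of (⟨(rho Λ) w, hw⟩ : ↥Λ))) x) (1 : ℂ)) =
          if (σ w) x = (σ (FreeGroup.of (⟨(rho Λ) w, hw⟩ : ↥Λ))) x then (1 : ℂ) else 0 := fun x =>
        inner_single_single _ _
      rw [sum_congr rfl fun x _ => h2 x]
      by_cases hwt : w = FreeGroup.of (⟨(rho Λ) w, hw⟩ : ↥Λ)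
      · rw [if_pos ⟨_, hw, hwt⟩, ← hwt]; simp
      · rw [if_neg]
        · symm
          refine sum_eq_zero fun x _ => if_neg ?_
          intro hx
          have hτ : τ w = w * (FreeGroup.of (⟨(rho Λ) w, hw⟩ : ↥Λ))⁻¹ := dif_pos hw
          refine hs2 ?_ ((σ (FreeGroup.of (⟨(rho Λ) w, hw⟩ : ↥Λ))) x) ?_
          · show τ w ≠ 1
            rw [hτ]
            intro h
            exact hwt (mul_inv_eq_one.1 h)
          · show σ (τ w) _ = _
            rw [hτ, ← Equiv.Perm.mul_apply, ← map_mul, inv_mul_cancel_right, hx]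
        · rintro ⟨t, ht, h⟩
          apply hwt
          have : rho Λ w = t := by rw [h]; exact rho_of _
          conv_lhs => rw [h]
          congr 2
          exact this.symm
  rw [← hfin] at key
  exact nonneg_of_mul_nonneg_right key (by exact_mod_cast hn)

end sidonpd


open scoped ComplexOrder
section bessel
open Finset

/-- Bessel families. -/
def Bessel {J R : Type} [NormedAddCommGroup R] [InnerProductSpace ℂ R] (κ : ℝ) (k : J → R) : Prop :=
  ∀ (s : Finset J) (c : J → ℂ), ‖∑ j ∈ s, c j • k j‖ ^ 2 ≤ κ * ∑ j ∈ s, ‖c j‖ ^ 2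

theorem Bessel.dual {J R : Type} [NormedAddCommGroup R] [InnerProductSpace ℂ R] {κ : ℝ} {k : J → R}
    (hκ : 0 ≤ κ) (h : Bessel κ k) (η : R) (s : Finset J) : ∑ j ∈ s, ‖inner ℂ (k j) η‖ ^ 2 ≤ κ * ‖η‖ ^ 2 := by
  set c : J → ℂ := fun j => inner ℂ (k j) η with hc
  set S := ∑ j ∈ s, ‖c j‖ ^ 2 with hS
  have h1 := h s c
  have h2 : (S : ℂ) = inner ℂ (∑ j ∈ s, c j • k j) η := by
    rw [sum_inner, hS]
    push_cast
    refine sum_congr rfl fun j _ => ?_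
    rw [inner_smul_left]
    exact (Complex.conj_mul' (c j)).symm
  have h3 : S ≤ ‖∑ j ∈ s, c j • k j‖ * ‖η‖ := by
    have := norm_inner_le_norm (𝕜 := ℂ) (∑ j ∈ s, c j • k j) η
    rw [← h2, Complex.norm_real] at this
    exact (le_abs_self S).trans this
  have hS0 : 0 ≤ S := by positivity
  rw [← hS] at h1
  show S ≤ _
  rcases hS0.eq_or_lt with h0 | h0
  · rw [← h0]
    positivity
  · have h4 : S ^ 2 ≤ (κ * S) * ‖η‖ ^ 2 := by
      calc S ^ 2 ≤ (‖∑ j ∈ s, c j • k j‖ * ‖η‖) ^ 2 := by gcongr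
        _ = ‖∑ j ∈ s, c j • k j‖ ^ 2 * ‖η‖ ^ 2 := by ring
        _ ≤ _ := by gcongr
    nlinarith


theorem Bessel.exists_op {J R E : Type} [NormedAddCommGroup R] [InnerProductSpace ℂ R] [CompleteSpace R]
    [NormedAddCommGroup E] [InnerProductSpace ℂ E] [CompleteSpace E] (b : HilbertBasis J ℂ E)
    {κ : ℝ} {k : J → R} (hκ : 0 ≤ κ) (h : Bessel κ k) :
    ∃ T : E →L[ℂ] E, 0 ≤ T ∧ ∀ i j, inner ℂ (b i) (T (b j)) = inner ℂ (k i) (k j) := by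
  have hmem : ∀ η : R, Memℓp (fun j => inner ℂ (k j) η) 2 := by
    intro η
    refine memℓp_gen' (C := κ * ‖η‖ ^ 2) fun s => ?_
    simpa using h.dual hκ η s
  let S0 : R →ₗ[ℂ] lp (fun _ : J => ℂ) 2 :=
    { toFun := fun η => ⟨fun j => inner ℂ (k j) η, hmem η⟩
      map_add' := by
        intro x y
        ext j
        exact inner_add_right _ _ _
      map_smul' := by
        intro c x
        ext j
        exact inner_smul_right _ _ _ }
  let S : R →L[ℂ] lp (fun _ : J => ℂ) 2 := S0.mkContinuous (Real.sqrt κ) (by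
    intro η
    refine lp.norm_le_of_forall_sum_le (by norm_num) (by positivity) fun s => ?_
    have h1 := h.dual hκ η s
    have : (Real.sqrt κ * ‖η‖) ^ 2 = κ * ‖η‖ ^ 2 := by rw [mul_pow, Real.sq_sqrt hκ]
    simp only [ENNReal.toReal_ofNat, Real.rpow_ofNat]
    rw [this]
    exact h1)
  let S' : R →L[ℂ] E := (b.repr.symm : lp (fun _ : J => ℂ) 2 →L[ℂ] E).comp S
  have hS' : ∀ i η, inner ℂ (b i) (S' η) = inner ℂ (k i) η := by
    intro i η
    rw [← b.repr_apply_apply]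
    simp [S', S, S0]
  have hadj : ∀ i, ContinuousLinearMap.adjoint S' (b i) = k i := by
    intro i
    refine ext_inner_right ℂ fun η => ?_
    rw [ContinuousLinearMap.adjoint_inner_left, hS']
  refine ⟨S'.comp (ContinuousLinearMap.adjoint S'), ?_, ?_⟩
  · rw [ContinuousLinearMap.nonneg_iff_isPositive]
    exact ContinuousLinearMap.isPositive_self_comp_adjoint S'
  · intro i j
    rw [ContinuousLinearMap.comp_apply, hadj, hS']

variable {F I E : Type} [Group F] [Fintype I] [NormedAddCommGroup E] [InnerProductSpace ℂ E] [CompleteSpace E]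

theorem exists_transl (b : HilbertBasis (F × I) ℂ E) (g : F) :
    ∃ u : E ≃ₗᵢ[ℂ] E, ∀ v q, u (b (v, q)) = b (g * v, q) := by
  let e : F × I ≃ F × I := Equiv.prodCongr (Equiv.mulLeft g) (Equiv.refl I)
  let b' : HilbertBasis (F × I) ℂ E := HilbertBasis.mk (v := fun i => b (e i))
    (b.orthonormal.comp e e.injective) (by
      have : Set.range (fun i => b (e i)) = Set.range b := e.surjective.range_comp b
      rw [this, b.dense_span])
  have hb' : ∀ i, b' i = b (e i) := fun i => by
    simp [b']
  refine ⟨b.repr.trans b'.repr.symm, fun v q => ?_⟩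
  classical
  rw [LinearIsometryEquiv.trans_apply, b.repr_self, b'.repr_symm_single, hb']
  rfl

theorem op_ext {J : Type} (b : HilbertBasis J ℂ E) {S T : E →L[ℂ] E}
    (h : ∀ i j, inner ℂ (b i) (S (b j)) = inner ℂ (b i) (T (b j))) : S = T := by
  have h1 : ∀ j, S (b j) = T (b j) := fun j => by
    apply b.repr.injective
    ext i
    rw [b.repr_apply_apply, b.repr_apply_apply, h]
  refine ContinuousLinearMap.ext_on (s := Set.range b) ?_ ?_
  · rw [← Submodule.dense_iff_topologicalClosure_eq_top.symm] 
    exact b.dense_span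
  · rintro _ ⟨j, rfl⟩
    exact h1 j

/-- invariance -/
def TInv (b : HilbertBasis (F × I) ℂ E) (T : E →L[ℂ] E) : Prop :=
  ∀ g v q w r, inner ℂ (b (g * v, q)) (T (b (g * w, r))) = inner ℂ (b (v, q)) (T (b (w, r)))

theorem inv_iff (b : HilbertBasis (F × I) ℂ E) (T : E →L[ℂ] E) (u : F → E ≃ₗᵢ[ℂ] E)
    (hu : ∀ g v q, u g (b (v, q)) = b (g * v, q)) : TInv b T ↔ ∀ g, Commute T (u g : E →L[ℂ] E) := by
  constructor
  · intro h g
    refine op_ext b ?_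
    rintro ⟨v, q⟩ ⟨w, r⟩
    show inner ℂ (b (v, q)) (T (u g (b (w, r)))) = inner ℂ (b (v, q)) (u g (T (b (w, r))))
    have e1 : b (v, q) = u g (b (g⁻¹ * v, q)) := by rw [hu, mul_inv_cancel_left]
    conv_rhs => rw [e1]
    rw [LinearIsometryEquiv.inner_map_map, hu]
    have h3 := h g (g⁻¹ * v) q w r
    rwa [mul_inv_cancel_left] at h3
  · intro h g v q w r
    rw [← hu, ← hu]
    have e1 : T (u g (b (w, r))) = u g (T (b (w, r))) := DFunLike.congr_fun (h g) (b (w, r))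
    rw [e1, LinearIsometryEquiv.inner_map_map]

theorem hasSum_fiber {f : F × I → ℂ} {a : ℂ} (h : HasSum f a) : HasSum (fun w => ∑ q, f (w, q)) a :=
  h.prod_fiberwise fun _ => hasSum_fintype _

theorem hasSum_trace (b : HilbertBasis (F × I) ℂ E) (A B : E →L[ℂ] E) :
    HasSum (fun w => ∑ p, ∑ q, inner ℂ (b (1, p)) (A (b (w, q))) * inner ℂ (b (w, q)) (B (b (1, p))))
      (∑ p, inner ℂ (b (1, p)) (A (B (b (1, p))))) := by
  refine hasSum_sum fun p _ => ?_
  refine hasSum_fiber (f := fun j => inner ℂ (b (1, p)) (A (b j)) * inner ℂ (b j) (B (b (1, p)))) ?_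
  have := b.hasSum_inner_mul_inner (ContinuousLinearMap.adjoint A (b (1, p))) (B (b (1, p)))
  simpa only [ContinuousLinearMap.adjoint_inner_left] using this

theorem trace_comm (b : HilbertBasis (F × I) ℂ E) (A B : E →L[ℂ] E) (hA : TInv b A) (hB : TInv b B) :
    (∑ p, inner ℂ (b (1, p)) (A (B (b (1, p))))) = ∑ p, inner ℂ (b (1, p)) (B (A (b (1, p)))) := by
  have h1 := hasSum_trace b A B
  have h2 := hasSum_trace b B A
  rw [← (Equiv.inv F).hasSum_iff] at h2
  refine h1.unique ?_
  convert h2 using 1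
  funext w
  simp only [Function.comp, Equiv.inv_apply]
  rw [Finset.sum_comm]
  refine sum_congr rfl fun q _ => sum_congr rfl fun p _ => ?_
  rw [← hA w w⁻¹ p 1 q, ← hB w 1 q w⁻¹ p, mul_inv_cancel, mul_one, mul_comm]

theorem trace_pos (b : HilbertBasis (F × I) ℂ E) (A B : E →L[ℂ] E) (hA : TInv b A) (hB : TInv b B)
    (hA0 : 0 ≤ A) (hB0 : 0 ≤ B) : 0 ≤ (∑ p, inner ℂ (b (1, p)) (A (B (b (1, p))))).re := by
  choose u hu using exists_transl b
  have hY : TInv b (CFC.sqrt B) := by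
    rw [inv_iff b _ u hu] at hB ⊢
    intro g
    exact (hB g).cfcₙ_nnreal _
  have hAY : TInv b (A * CFC.sqrt B) := by
    rw [inv_iff b _ u hu] at hA hY ⊢
    intro g
    exact (hA g).mul_left (hY g)
  have h1 := trace_comm b _ _ hAY hY
  have hYY : ∀ x, CFC.sqrt B (CFC.sqrt B x) = B x := fun x =>
    DFunLike.congr_fun (CFC.sqrt_mul_sqrt_self B hB0) x
  simp only [mul_apply_eq_comp, hYY] at h1
  rw [h1, Complex.re_sum]
  refine sum_nonneg fun p _ => ?_
  have hsa : IsSelfAdjoint (CFC.sqrt B) := (CFC.sqrt_nonneg B).isSelfAdjoint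
  have h2 : inner ℂ (b (1, p)) (CFC.sqrt B (A (CFC.sqrt B (b (1, p)))))
      = inner ℂ (CFC.sqrt B (b (1, p))) (A (CFC.sqrt B (b (1, p)))) := by
    rw [← ContinuousLinearMap.adjoint_inner_left, hsa.adjoint_eq]
  rw [h2]
  rw [ContinuousLinearMap.nonneg_iff_isPositive] at hA0
  exact hA0.re_inner_nonneg_right _

theorem trace_kernel (x l : I → I → F → ℂ) {R R' : Type} [NormedAddCommGroup R] [InnerProductSpace ℂ R] [CompleteSpace R]
    [NormedAddCommGroup R'] [InnerProductSpace ℂ R'] [CompleteSpace R'] {κ κ' : ℝ} (hκ : 0 ≤ κ) (hκ' : 0 ≤ κ')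
    (k : F × I → R) (k' : F × I → R') (hk : Bessel κ k) (hk' : Bessel κ' k')
    (hx : ∀ i j, inner ℂ (k i) (k j) = x i.2 j.2 (i.1⁻¹ * j.1))
    (hl : ∀ i j, inner ℂ (k' i) (k' j) = l i.2 j.2 (i.1⁻¹ * j.1)) :
    ∃ a : ℂ, 0 ≤ a.re ∧ HasSum (fun w => ∑ p, ∑ q, star (l p q w) * x p q w) a := by
  let b : HilbertBasis (F × I) ℂ (lp (fun _ : F × I => ℂ) 2) := HilbertBasis.ofRepr (LinearIsometryEquiv.refl ℂ _)
  obtain ⟨X, hX0, hX⟩ := hk.exists_op b hκ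
  obtain ⟨L, hL0, hL⟩ := hk'.exists_op b hκ'
  have iX : TInv b X := by
    intro g v q w r
    rw [hX, hX, hx, hx]; simp [mul_assoc]
  have iL : TInv b L := by
    intro g v q w r
    rw [hL, hL, hl, hl]; simp [mul_assoc]
  refine ⟨_, trace_pos b L X iL iX hL0 hX0, ?_⟩
  have h1 := hasSum_trace b L X
  rw [← (Equiv.inv F).hasSum_iff] at h1
  convert h1 using 1
  funext w
  simp only [Function.comp, Equiv.inv_apply]
  rw [Finset.sum_comm]
  refine sum_congr rfl fun q _ => sum_congr rfl fun p _ => ?_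
  have e1 : l p q w = inner ℂ (k' (w⁻¹, p)) (k' (1, q)) := by rw [hl]; simp
  have e2 : x p q w = inner ℂ (k (w⁻¹, p)) (k (1, q)) := by rw [hx]; simp
  rw [hL, hX, e1, e2, ← inner_conj_symm (k' (1, q))]
  rfl

end bessel


open scoped ComplexOrder
section lemmaL
open Finset

theorem nonneg_of_functionals {A : Type} [CStarAlgebra A] [PartialOrder A] [StarOrderedRing A] (a : A)
    (ha : IsSelfAdjoint a)
    (h : ∀ ω : A →L[ℂ] ℂ, (∀ b, 0 ≤ b → 0 ≤ ω b) → 0 ≤ (ω a).re) : 0 ≤ a := by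
  by_contra hn
  let K : ProperCone ℝ A :=
    { carrier := {b | 0 ≤ b + star b}
      add_mem' := by
        intro b c hb hc
        simp only [Set.mem_setOf_eq] at hb hc ⊢
        rw [star_add, add_add_add_comm]
        exact add_nonneg hb hc
      zero_mem' := by simp
      smul_mem' := by
        intro r b hb
        simp only [Set.mem_setOf_eq] at hb ⊢
        have : r • b + star (r • b) = (r : ℝ) • (b + star b) := by
          show (r : ℝ) • b + star ((r : ℝ) • b) = _
          rw [star_smul, smul_add]; simp
        rw [this]
        exact smul_nonneg r.2 hb
      isClosed' := by
        have : IsClosed {b : A | 0 ≤ b} := CStarAlgebra.isClosed_nonneg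
        exact this.preimage (by fun_prop : Continuous fun b : A => b + star b) }
  have hK : ∀ b, b ∈ K ↔ 0 ≤ b + star b := fun b => Iff.rfl
  obtain ⟨f, hf, hfa⟩ := ProperCone.hyperplane_separation_point K (x₀ := a) (by
    rw [hK, ha.star_eq]
    intro h2
    apply hn
    have : a = (2⁻¹ : ℝ) • (a + a) := by rw [← two_smul ℝ a, smul_smul]; norm_num
    rw [this]
    exact smul_nonneg (by norm_num) h2)
  let ω : A →L[ℂ] ℂ := StrongDual.extendRCLike (𝕜 := ℂ) f
  have hre : ∀ b, (ω b).re = f b := fun b => StrongDual.re_extendRCLike_apply (𝕜 := ℂ) f b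
  have := h ω fun b hb => by
    have hbs : star b = b := hb.isSelfAdjoint.star_eq
    have h1 : 0 ≤ f (Complex.I • b) := hf _ (by rw [hK, star_smul, hbs]; simp)
    have h2 : 0 ≤ f (-(Complex.I • b)) := hf _ (by rw [hK, star_neg, star_smul, hbs]; simp)
    rw [map_neg] at h2
    have h3 : (ω (Complex.I • b)).re = - (ω b).im := by rw [map_smul]; simp
    rw [Complex.nonneg_iff, hre]
    refine ⟨hf _ (by rw [hK, hbs]; exact add_nonneg hb hb), ?_⟩
    rw [hre] at h3
    linarith
  rw [hre] at this
  linarith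

theorem KPos.conj {ι : Type} {k : ι → ι → ℂ} (hk : KPos k) : KPos (fun i j => star (k i j)) := by
  intro n t z
  have h := star_nonneg_iff.2 (hk n t (fun i => star (z i)))
  refine h.trans_eq ?_
  simp only [star_sum, star_mul', star_star]

theorem KPos.map {ι A : Type} [CStarAlgebra A] [PartialOrder A] [StarOrderedRing A] {k : ι → ι → A}
    (hk : KPos k) (ω : A →L[ℂ] ℂ) (hω : ∀ b, 0 ≤ b → 0 ≤ ω b) : KPos (fun i j => ω (k i j)) := by
  intro n t z
  have h := hω _ (hk n t (fun i => z i • (1 : A)))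
  refine h.trans_eq ?_
  simp only [map_sum, star_smul, star_one, smul_mul_assoc, one_mul, mul_smul_comm, mul_one, map_smul, smul_eq_mul]
  refine sum_congr rfl fun i _ => sum_congr rfl fun j _ => by ring

theorem norm_sq_sum_eq {J R : Type} [NormedAddCommGroup R] [InnerProductSpace ℂ R] (k : J → R) (s : Finset J)
    (c : J → ℂ) : ((‖∑ j ∈ s, c j • k j‖ ^ 2 : ℝ) : ℂ) = ∑ i ∈ s, ∑ j ∈ s, star (c i) * inner ℂ (k i) (k j) * c j := by
  have h := inner_self_eq_norm_sq_to_K (𝕜 := ℂ) (∑ j ∈ s, c j • k j)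
  push_cast
  rw [← Complex.coe_algebraMap, ← h, sum_inner]
  simp only [inner_sum, inner_smul_left, inner_smul_right]
  refine Finset.sum_congr rfl fun i _ => Finset.sum_congr rfl fun j _ => ?_
  simp; ring

theorem dsum_eq {J : Type} [DecidableEq J] (d : J → ℝ) (s : Finset J) (c : J → ℂ) :
    ∑ i ∈ s, ∑ j ∈ s, star (c i) * (if i = j then (d i : ℂ) else 0) * c j = ((∑ i ∈ s, d i * ‖c i‖ ^ 2 : ℝ) : ℂ) := by
  push_cast
  refine sum_congr rfl fun i hi => ?_
  rw [sum_eq_single i]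
  · rw [if_pos rfl, ← Complex.conj_mul']; simp; ring
  · intro j _ hj; simp [hj.symm]
  · intro h; exact absurd hi h

theorem Bessel.of_dom {J R : Type} [DecidableEq J] [NormedAddCommGroup R] [InnerProductSpace ℂ R] (k : J → R) (d : J → ℝ)
    {κ : ℝ} (hd : ∀ i, d i ≤ κ)
    (h : KPos (fun i j => (if i = j then (d i : ℂ) else 0) - inner ℂ (k i) (k j))) : Bessel κ k := by
  intro s c
  have h1 := h.finset s c
  simp only [mul_sub, sub_mul, sum_sub_distrib] at h1
  rw [dsum_eq, ← norm_sq_sum_eq, sub_nonneg, Complex.real_le_real] at h1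
  refine h1.trans ?_
  rw [mul_sum]
  exact sum_le_sum fun i _ => mul_le_mul_of_nonneg_right (hd i) (sq_nonneg _)

theorem Bessel.dom {J R : Type} [DecidableEq J] [NormedAddCommGroup R] [InnerProductSpace ℂ R] {k : J → R}
    {κ : ℝ} (h : Bessel κ k) : KPos (fun i j => (if i = j then (κ : ℂ) else 0) - inner ℂ (k i) (k j)) := by
  refine KPos.of_posSemidef ⟨?_, fun x => ?_⟩
  · ext i j
    by_cases hij : i = j
    · subst hij; simp
    · simp [hij, Ne.symm hij]
  · have h1 := h x.support x
    simp only [Finsupp.sum, Matrix.of_apply, mul_sub, sub_mul, sum_sub_distrib]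
    rw [dsum_eq (fun _ => κ), ← norm_sq_sum_eq, sub_nonneg, Complex.real_le_real, ← mul_sum]
    exact h1

theorem Bessel.orth {J R : Type} [DecidableEq J] [NormedAddCommGroup R] [InnerProductSpace ℂ R] {k : J → R}
    {κ : ℝ} (h : ∀ i j, inner ℂ (k i) (k j) = if i = j then (κ : ℂ) else 0) : Bessel κ k := by
  intro s c
  have h1 := norm_sq_sum_eq k s c
  simp only [h] at h1
  rw [dsum_eq (fun _ => κ), Complex.ofReal_inj, ← mul_sum] at h1
  exact h1.le

theorem Bessel.union {F I R : Type} [Fintype I] [NormedAddCommGroup R] [InnerProductSpace ℂ R] {k : F × I → R}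
    {κ : ℝ} (h : ∀ p, Bessel κ (fun w => k (w, p))) : Bessel (Fintype.card I * κ) k := by
  classical
  intro s c
  have e1 : ∀ {M : Type} [AddCommMonoid M] (f : F × I → M), ∑ j ∈ s, f j
      = ∑ p, ∑ w ∈ (s.filter (fun j => j.2 = p)).image Prod.fst, f (w, p) := by
    intro M _ f
    rw [← sum_fiberwise s Prod.snd f]
    refine sum_congr rfl fun p _ => ?_
    rw [sum_image]
    · refine sum_congr rfl fun j hj => ?_
      rw [mem_filter] at hj
      rw [← hj.2]
    · intro a ha b hb hab
      simp only [coe_filter, Set.mem_setOf_eq] at ha hb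
      exact Prod.ext hab (ha.2.trans hb.2.symm)
  rw [e1, e1 (fun j => ‖c j‖ ^ 2)]
  have h2 : ∀ y : I → R, ‖∑ p, y p‖ ^ 2 ≤ Fintype.card I * ∑ p, ‖y p‖ ^ 2 := by
    intro y
    have := sq_sum_le_card_mul_sum_sq (s := (univ : Finset I)) (f := fun p => ‖y p‖)
    refine le_trans ?_ this
    gcongr
    exact norm_sum_le _ _
  refine (h2 _).trans ?_
  rw [mul_assoc]
  refine mul_le_mul_of_nonneg_left ?_ (Nat.cast_nonneg _)
  rw [mul_sum]
  exact sum_le_sum fun p _ => h p _ (fun w => c (w, p))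

variable {F I : Type} [Group F] {C : ℝ} {X : I → I → F → ℂ}

theorem L_sum (hC : 0 ≤ C) (hX : KPos (fun i j : F × I => X i.2 j.2 (i.1⁻¹ * j.1)))
    (hd : ∀ p w, (w = 1 → X p p w = C) ∧ (w ≠ 1 → X p p w = 0)) (p q : I) :
    Summable (fun w => ‖X p q w‖ ^ 2) ∧ ∑' w, ‖X p q w‖ ^ 2 ≤ C ^ 2 := by
  classical
  obtain ⟨R, _, _, _, k, hk⟩ := hX.kolmogorov
  have hB : Bessel C (fun w : F => k (w⁻¹, p)) := by
    refine Bessel.orth fun v w => ?_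
    rw [hk]
    by_cases h : v = w
    · rw [if_pos h, (hd _ _).1 (by simp [h])]
    · rw [if_neg h, (hd _ _).2]
      intro h2
      apply h
      simpa [mul_inv_eq_one] using h2
  have h1 : ∀ s : Finset F, ∑ w ∈ s, ‖X p q w‖ ^ 2 ≤ C ^ 2 := by
    intro s
    have h2 := hB.dual hC (k (1, q)) s
    have h3 : ‖k (1, q)‖ ^ 2 = C := by
      have := inner_self_eq_norm_sq_to_K (𝕜 := ℂ) (k (1, q))
      rw [hk, (hd _ _).1 (by simp)] at this
      have h4 : ((C : ℝ) : ℂ) = ((‖k (1, q)‖ ^ 2 : ℝ) : ℂ) := by rw [this]; simp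
      exact (Complex.ofReal_inj.1 h4).symm
    rw [h3] at h2
    refine le_trans (le_of_eq ?_) (h2.trans (by rw [sq]))
    refine sum_congr rfl fun w _ => ?_
    rw [hk]; simp
  exact ⟨summable_of_sum_le (fun _ => sq_nonneg _) h1, Real.tsum_le_of_sum_le (fun _ => sq_nonneg _) h1⟩

end lemmaL


open scoped ComplexOrder
section lemmaL
open Finset

variable {F I A : Type} [Group F] {C : ℝ} {X : I → I → F → ℂ} [CStarAlgebra A]

theorem L_summable {H : F → A} (hH : ∀ w, ‖H w‖ ≤ 1) {y : F → ℂ} (hy : Summable (fun w => ‖y w‖ ^ 2)) :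
    Summable (fun w => ((‖y w‖ ^ 2 : ℝ) : ℂ) • H w) := by
  refine Summable.of_norm_bounded hy fun w => ?_
  rw [norm_smul, Complex.norm_real, Real.norm_of_nonneg (sq_nonneg _)]
  exact mul_le_of_le_one_right (sq_nonneg _) (hH w)

variable [PartialOrder A] [StarOrderedRing A]

theorem L_pos_aux [Fintype I] (hC : 0 ≤ C) (hX : KPos (fun i j : F × I => X i.2 j.2 (i.1⁻¹ * j.1)))
    (hd : ∀ p w, (w = 1 → X p p w = C) ∧ (w ≠ 1 → X p p w = 0)) {H : F → A}
    (hH : ∀ w, ‖H w‖ ≤ 1) (hHp : KPos (fun v w : F => H (v⁻¹ * w))) (z : I → A) :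
    0 ≤ ∑ p, ∑ q, star (z p) * (∑' w, ((‖X p q w‖ ^ 2 : ℝ) : ℂ) • H w) * z q := by
  classical
  have hs : ∀ p q, HasSum (fun w => star (z p) * (((‖X p q w‖ ^ 2 : ℝ) : ℂ) • H w) * z q)
      (star (z p) * (∑' w, ((‖X p q w‖ ^ 2 : ℝ) : ℂ) • H w) * z q) := fun p q =>
    ((L_summable hH (L_sum hC hX hd p q).1).hasSum.mul_left _).mul_right _
  have hHs : ∀ w, star (H w) = H w⁻¹ := fun w => by simpa using hHp.herm 1 w
  have hXs : ∀ p q w, ‖X p q w⁻¹‖ = ‖X q p w‖ := fun p q w => by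
    have := hX.herm (1, q) (w, p)
    simp only [inv_one, one_mul, mul_one] at this
    rw [← this, norm_star]
  have hS : HasSum (fun w => ∑ p, ∑ q, star (z p) * (((‖X p q w‖ ^ 2 : ℝ) : ℂ) • H w) * z q)
      (∑ p, ∑ q, star (z p) * (∑' w, ((‖X p q w‖ ^ 2 : ℝ) : ℂ) • H w) * z q) :=
    hasSum_sum fun p _ => hasSum_sum fun q _ => hs p q
  set L := ∑ p, ∑ q, star (z p) * (∑' w, ((‖X p q w‖ ^ 2 : ℝ) : ℂ) • H w) * z q with hL
  refine nonneg_of_functionals L ?_ ?_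
  · have h1 := hS.star
    rw [← (Equiv.inv F).hasSum_iff] at h1
    refine h1.unique ?_
    convert hS using 1
    funext w
    simp only [Function.comp, Equiv.inv_apply, star_sum]
    rw [sum_comm]
    refine sum_congr rfl fun p _ => sum_congr rfl fun q _ => ?_
    rw [star_mul, star_mul, star_star, star_smul, hHs, inv_inv, hXs, mul_assoc]
    simp
  · intro ω hω
    obtain ⟨R, _, _, _, k, hk⟩ := hX.kolmogorov
    have hB : Bessel (Fintype.card I * C) k := by
      refine Bessel.union fun p => Bessel.orth fun v w => ?_
      rw [hk]
      by_cases h : v = w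
      · rw [if_pos h, (hd _ _).1 (by simp [h])]
      · rw [if_neg h, (hd _ _).2]
        intro h2
        apply h
        simpa [inv_mul_eq_one] using h2
    have hh : KPos (fun i j : F × I => ω (star (z i.2) * H (i.1⁻¹ * j.1) * z j.2)) :=
      ((hHp.comp (Prod.fst : F × I → F)).const_mul (fun i => z i.2)).map ω hω
    have hl := hX.schur hh.conj
    have hdom := hB.dom.schur hh.conj
    simp only [hk] at hdom
    obtain ⟨R', _, _, _, k', hk'⟩ := hl.kolmogorov
    set e : I → ℝ := fun p => Fintype.card I * C * (ω (star (z p) * H 1 * z p)).re with he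
    have hre : ∀ p, 0 ≤ ω (star (z p) * H 1 * z p) := fun p => by
      have := hh 1 (fun _ => (1, p)) (fun _ => 1)
      simpa using this
    have he0 : ∀ p, 0 ≤ e p := fun p =>
      mul_nonneg (by positivity) (Complex.nonneg_iff.1 (hre p)).1
    have hB' : Bessel (∑ p, e p) k' := by
      refine Bessel.of_dom k' (fun i => e i.2) (fun i => single_le_sum (f := e) (fun p _ => he0 p) (mem_univ _)) ?_
      refine hdom.congr fun i j => ?_
      rw [hk', sub_smul]
      congr 1
      by_cases hij : i = j
      · subst hij
        rw [if_pos rfl, if_pos rfl, inv_mul_cancel]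
        have h5 : ω (star (z i.2) * H 1 * z i.2) = ((ω (star (z i.2) * H 1 * z i.2)).re : ℂ) := by
          refine Complex.ext (by simp) ?_
          simpa using (Complex.nonneg_iff.1 (hre i.2)).2.symm
        rw [h5]
        simp [he]
      · rw [if_neg hij, if_neg hij, zero_smul]
    obtain ⟨a, ha, haS⟩ := trace_kernel X (fun p q w => X p q w • star (ω (star (z p) * H w * z q)))
      (by positivity : 0 ≤ Fintype.card I * C) (sum_nonneg fun p _ => he0 p) k k' hB hB' hk hk'
    have h7 : ω L = a := by
      refine (hS.mapL ω).unique ?_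
      convert haS using 1
      funext w
      simp only [map_sum]
      refine sum_congr rfl fun p _ => sum_congr rfl fun q _ => ?_
      rw [mul_smul_comm, smul_mul_assoc, map_smul, smul_eq_mul, smul_eq_mul, star_mul', star_star]
      push_cast
      rw [← Complex.conj_mul']
      simp; ring
    rw [h7]; exact ha

theorem L_pos (hC : 0 ≤ C) (hX : KPos (fun i j : F × I => X i.2 j.2 (i.1⁻¹ * j.1)))
    (hd : ∀ p w, (w = 1 → X p p w = C) ∧ (w ≠ 1 → X p p w = 0)) {H : F → A}
    (hH : ∀ w, ‖H w‖ ≤ 1) (hHp : KPos (fun v w : F => H (v⁻¹ * w))) :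
    KPos (fun p q => ∑' w, ((‖X p q w‖ ^ 2 : ℝ) : ℂ) • H w) := by
  intro n t z
  exact L_pos_aux (X := fun a b => X (t a) (t b)) hC
    (hX.comp (fun i : F × Fin n => (i.1, t i.2))) (fun p => hd (t p)) hH hHp z

end lemmaL


open scoped ComplexOrder
section assembly
open Finset

theorem KPos.sumfib {J I A : Type} [CStarAlgebra A] [PartialOrder A] [StarOrderedRing A] [Fintype I]
    {k : J × I → J × I → A} (hk : KPos k) : KPos (fun a b => ∑ i, ∑ j, k (a, i) (b, j)) := by
  intro n t z
  have h := hk.fin (fun c : Fin n × I => (t c.1, c.2)) (fun c => z c.1)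
  refine h.trans_eq ?_
  simp only [Fintype.sum_prod_type, mul_sum, sum_mul]
  refine sum_congr rfl fun a _ => ?_
  rw [sum_comm]

variable {G : Type} [Group G] {Λ : Set G} {A : Type} [CStarAlgebra A]

open Classical in
/-- restriction to a fibre of `rho` -/
noncomputable def yr (x : Fin 2 × Fin 2 × FreeGroup ↥Λ → ℂ) (i j : Fin 2) (g : G) (w : FreeGroup ↥Λ) : ℂ :=
  if rho Λ w = g then x (i, j, w) else 0

/-- averaged coefficients -/
noncomputable def Qr (x : Fin 2 × Fin 2 × FreeGroup ↥Λ → ℂ) (H : FreeGroup ↥Λ → A) (i j : Fin 2) (g : G) : A :=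
  ∑' w, ((‖yr x i j g w‖ ^ 2 : ℝ) : ℂ) • H w

variable {x : Fin 2 × Fin 2 × FreeGroup ↥Λ → ℂ} {C : ℝ}

theorem C_nonneg (hx : PD2 x) (hx0 : ∀ p ∈ goodT Λ, x p = X0 Λ C p) : 0 ≤ C := by
  have h := hx 1 (fun _ => (0, 1)) (fun _ => 1)
  have h1 : x (0, 0, 1) = C := by
    rw [hx0 _ (Or.inl ⟨rfl, map_one _⟩)]; simp [X0]
  simp [h1] at h
  exact h

theorem yr_pos (hx : PD2 x) : KPos (fun i j : FreeGroup ↥Λ × (G × Fin 2) =>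
    yr x i.2.2 j.2.2 (i.2.1⁻¹ * j.2.1) (i.1⁻¹ * j.1)) := by
  classical
  have h := KPos.block (fun i : FreeGroup ↥Λ × (G × Fin 2) => i.2.1 * (rho Λ i.1)⁻¹)
    (fun _ i j => x (i.2.2, j.2.2, i.1⁻¹ * j.1))
    (fun _ => KPos.comp hx (fun i : FreeGroup ↥Λ × (G × Fin 2) => (i.2.2, i.1)))
  refine h.congr fun i j => ?_
  unfold yr
  refine if_congr ?_ rfl rfl
  rw [map_mul, map_inv]
  constructor
  · intro h
    rw [mul_inv_eq_iff_eq_mul, mul_assoc, eq_comm, ← eq_mul_inv_iff_mul_eq] 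
    have : rho Λ j.1 = rho Λ i.1 * (i.2.1⁻¹ * j.2.1) := by rw [← h]; group
    rw [this]; group
  · intro h
    have : i.2.1 = j.2.1 * (rho Λ j.1)⁻¹ * rho Λ i.1 := by rw [← h]; group
    rw [this]; group

theorem yr_diag (hx0 : ∀ p ∈ goodT Λ, x p = X0 Λ C p) (p : G × Fin 2) (w : FreeGroup ↥Λ) :
    (w = 1 → yr x p.2 p.2 (p.1⁻¹ * p.1) w = C) ∧ (w ≠ 1 → yr x p.2 p.2 (p.1⁻¹ * p.1) w = 0) := by
  unfold yr
  rw [inv_mul_cancel]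
  constructor
  · rintro rfl
    rw [if_pos (map_one _), hx0 _ (Or.inl ⟨rfl, map_one _⟩)]; simp [X0]
  · intro h
    by_cases h1 : rho Λ w = 1
    · rw [if_pos h1, hx0 _ (Or.inl ⟨rfl, h1⟩)]; simp [X0, h]
    · rw [if_neg h1]

theorem yr_sum (hx : PD2 x) (hx0 : ∀ p ∈ goodT Λ, x p = X0 Λ C p) (i j : Fin 2) (g : G) :
    Summable (fun w => ‖yr x i j g w‖ ^ 2) ∧ ∑' w, ‖yr x i j g w‖ ^ 2 ≤ C ^ 2 := by
  have := L_sum (X := fun (p q : G × Fin 2) w => yr x p.2 q.2 (p.1⁻¹ * q.1) w) (C_nonneg hx hx0)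
    (yr_pos hx) (yr_diag hx0) (1, i) (g, j)
  simpa using this

theorem yr_norm (hx : PD2 x) (hx0 : ∀ p ∈ goodT Λ, x p = X0 Λ C p) (i j : Fin 2) (g : G)
    {H : FreeGroup ↥Λ → A} {r : ℝ} (hr : 0 ≤ r) (hH : ∀ w, rho Λ w = g → ‖H w‖ ≤ r) :
    ‖∑' w, ((‖yr x i j g w‖ ^ 2 : ℝ) : ℂ) • H w‖ ≤ C ^ 2 * r := by
  obtain ⟨h1, h2⟩ := yr_sum hx hx0 i j g
  refine (tsum_of_norm_bounded (h1.hasSum.mul_right r) fun w => ?_).trans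
    (mul_le_mul_of_nonneg_right h2 hr)
  rw [norm_smul, Complex.norm_real, Real.norm_of_nonneg (sq_nonneg _)]
  by_cases h : rho Λ w = g
  · exact mul_le_mul_of_nonneg_left (hH w h) (sq_nonneg _)
  · simp [yr, h]

theorem Qr_norm (hx : PD2 x) (hx0 : ∀ p ∈ goodT Λ, x p = X0 Λ C p) (i j : Fin 2) (g : G)
    {H : FreeGroup ↥Λ → A} (hH : ∀ w, ‖H w‖ ≤ 1) : ‖Qr x H i j g‖ ≤ C ^ 2 := by
  have := yr_norm hx hx0 i j g (H := H) zero_le_one (fun w _ => hH w)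
  rwa [mul_one] at this

theorem Qr_01 (hx0 : ∀ p ∈ goodT Λ, x p = X0 Λ C p) (t : ↥Λ) (H : FreeGroup ↥Λ → A) :
    Qr x H 0 1 (t : G) = H (FreeGroup.of t) := by
  unfold Qr
  have hgood : ∀ w, rho Λ w = (t : G) → x (0, 1, w) = X0 Λ C (0, 1, w) := fun w hw =>
    hx0 _ (Or.inr ⟨rfl, rfl, by rw [hw]; exact t.2⟩)
  rw [tsum_eq_single (FreeGroup.of t)]
  · simp [yr, rho_of, hgood _ (rho_of t), X0]
  · intro w hw
    by_cases h : rho Λ w = (t : G)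
    · have : ¬ ∃ t', w = FreeGroup.of t' := by
        rintro ⟨t', rfl⟩
        rw [rho_of] at h
        exact hw (by rw [Subtype.ext h])
      simp [yr, h, hgood _ h, X0, this]
    · simp [yr, h]

theorem Qr_10 (hx : PD2 x) (hx0 : ∀ p ∈ goodT Λ, x p = X0 Λ C p) (t : ↥Λ) (ht : (t : G)⁻¹ ∈ Λ)
    (H : FreeGroup ↥Λ → A) :
    Qr x H 1 0 (t : G) = H (FreeGroup.of ⟨(t : G)⁻¹, ht⟩)⁻¹ := by
  have h1 : Qr x H 1 0 (t : G) = Qr x (fun w => H w⁻¹) 0 1 ((t : G)⁻¹) := by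
    unfold Qr
    rw [← (Equiv.inv _).tsum_eq]
    refine tsum_congr fun w => ?_
    have h2 := hx.herm (0, 1) (1, w)
    simp only [inv_one, one_mul, mul_one] at h2
    simp only [Equiv.inv_apply]
    have h3 : ‖yr x 1 0 (t : G) w⁻¹‖ = ‖yr x 0 1 ((t : G)⁻¹) w‖ := by
      by_cases h : rho Λ w = (t : G)⁻¹
      · simp only [yr, map_inv, h, inv_inv, if_true]
        rw [← h2, norm_star]
      · have h' : ¬ (rho Λ w)⁻¹ = (t : G) := fun h4 => h (by rw [← h4, inv_inv])
        simp only [yr, map_inv, h, h', if_false]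
    rw [h3]
  rw [h1]
  exact Qr_01 hx0 ⟨(t : G)⁻¹, ht⟩ (fun w => H w⁻¹)

theorem Qr_pos [PartialOrder A] [StarOrderedRing A] (hx : PD2 x) (hx0 : ∀ p ∈ goodT Λ, x p = X0 Λ C p)
    {H : FreeGroup ↥Λ → A} (hH : ∀ w, ‖H w‖ ≤ 1) (hHp : KPos (fun v w => H (v⁻¹ * w))) (b : Fin 2 → ℂ) :
    KPos (fun g h : G => ∑ i, ∑ j, (star (b i) * b j) • Qr x H i j (g⁻¹ * h)) := by
  have h1 := L_pos (X := fun (p q : G × Fin 2) w => yr x p.2 q.2 (p.1⁻¹ * q.1) w) (C_nonneg hx hx0)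
    (yr_pos hx) (yr_diag hx0) hH hHp
  have h2 := (h1.const_mul (fun p => b p.2 • (1 : A))).sumfib
  refine h2.congr fun g h => sum_congr rfl fun i _ => sum_congr rfl fun j _ => ?_
  simp [Qr, smul_smul, mul_comm]

theorem diag_bound [DecidableEq ↥Λ] (hΛ1 : (1 : G) ∉ Λ) (hx : PD2 x) (hx0 : ∀ p ∈ goodT Λ, x p = X0 Λ C p) {c : ↥Λ → A} {ε : ℝ}
    (hε₀ : 0 ≤ ε) (hε₁ : ε ≤ 1) (hc : ∀ t, ‖c t‖ ≤ ε) (i : Fin 2) (s : ↥Λ) :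
    ‖Qr x (haag c) i i (s : G) + Qr x (haag fun t => - c t) i i (s : G)‖ ≤ C ^ 2 * (2 * ε ^ 2) := by
  have hle : ∀ w, ‖haag c w‖ ≤ 1 := fun w => (norm_haag_le c hε₀ hc w).trans (pow_le_one₀ hε₀ hε₁)
  have hle' : ∀ w, ‖haag (fun t => - c t) w‖ ≤ 1 := fun w =>
    (norm_haag_le _ hε₀ (by simpa using hc) w).trans (pow_le_one₀ hε₀ hε₁)
  have hs := (yr_sum hx hx0 i i (s : G)).1
  unfold Qr
  rw [← (L_summable hle hs).tsum_add (L_summable hle' hs)]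
  simp only [← smul_add]
  refine yr_norm hx hx0 i i (s : G) (by positivity) fun w hw => ?_
  rw [haag_neg]
  have hn := norm_haag_le c hε₀ hc w
  have h0 : w.toWord.length ≠ 0 := by
    intro h
    rw [List.length_eq_zero_iff, FreeGroup.toWord_eq_nil_iff] at h
    rw [h, map_one] at hw
    exact hΛ1 (hw ▸ s.2)
  by_cases h1 : w.toWord.length = 1
  · rw [h1]; simp; positivity
  · have h2 : ε ^ w.toWord.length ≤ ε ^ 2 := pow_le_pow_of_le_one hε₀ hε₁ (by omega)
    refine (norm_add_le _ _).trans ?_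
    rw [norm_smul, norm_pow, norm_neg, norm_one, one_pow, one_mul]
    linarith

theorem keyLemma_aux (hΛ1 : (1 : G) ∉ Λ) (hsym : Λ⁻¹ = Λ) (hΛ : IsCompletelySidon Λ C)
    (φ : ↥Λ → A)
    (hherm : ∀ (t : ↥Λ) (h : ((t : G))⁻¹ ∈ Λ), φ ⟨(t : G)⁻¹, h⟩ = star (φ t))
    (hbdd : ∀ t, ‖φ t‖ ≤ 1)
    (ε : ℝ) (hε₀ : 0 ≤ ε) (hε₁ : ε ≤ 1) :
    ∃ Φ : G → A, IsCompletelyPosDefFn Φ ∧ ‖Φ 1‖ ≤ 4 * C ^ 2 ∧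
      ∀ s : ↥Λ, ‖Φ s - ε • φ s‖ ≤ 4 * C ^ 2 * ε ^ 2 := by
  classical
  let _ := CStarAlgebra.spectralOrder A
  have _ := CStarAlgebra.spectralOrderedRing A
  obtain ⟨x, hx, hx0⟩ := sidon_PD2 hΛ
  set c : ↥Λ → A := fun t => ε • φ t with hcdef
  have hc : ∀ t, ‖c t‖ ≤ ε := fun t => by
    rw [hcdef]
    simp only [norm_smul, Real.norm_of_nonneg hε₀]
    exact mul_le_of_le_one_right hε₀ (hbdd t)
  have hc' : ∀ t, ‖- c t‖ ≤ ε := by simpa using hc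
  have hle : ∀ w, ‖haag c w‖ ≤ 1 := fun w => (norm_haag_le c hε₀ hc w).trans (pow_le_one₀ hε₀ hε₁)
  have hle' : ∀ w, ‖haag (fun t => - c t) w‖ ≤ 1 := fun w =>
    (norm_haag_le _ hε₀ hc' w).trans (pow_le_one₀ hε₀ hε₁)
  let P : Fin 2 → Fin 2 → G → A := Qr x (haag c)
  let N : Fin 2 → Fin 2 → G → A := Qr x (haag fun t => - c t)
  have k1 := Qr_pos hx hx0 hle (haag_pos c fun t => (hc t).trans hε₁) (fun _ => 1)
  have k2 := Qr_pos hx hx0 hle' (haag_pos _ fun t => (hc' t).trans hε₁) ![1, -1]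
  have h4 : (0 : ℂ) ≤ 1 / 4 := by
    have : (0 : ℂ) ≤ ((1 / 4 : ℝ) : ℂ) := Complex.zero_le_real.2 (by norm_num)
    simpa using this
  have k3 := (KPos.const (ι := G) (a := (1 / 4 : ℂ)) h4).schur (k1.add k2)
  let Φ : G → A := fun g => (1 / 4 : ℂ) • ((P 0 0 g + P 0 1 g + P 1 0 g + P 1 1 g)
    + (N 0 0 g - N 0 1 g - N 1 0 g + N 1 1 g))
  have hΦ : KPos (fun g h : G => Φ (g⁻¹ * h)) := by
    refine k3.congr fun g h => ?_
    simp only [Φ, P, N, Fin.sum_univ_two]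
    simp only [star_one, star_neg, Matrix.cons_val_zero, Matrix.cons_val_one]
    congr 1
    simp
    abel
  refine ⟨Φ, ?_, ?_, ?_⟩
  · intro n t
    exact (hΦ.comp t).factor
  · have p : ∀ i j, ‖P i j 1‖ ≤ C ^ 2 := fun i j => Qr_norm hx hx0 i j 1 hle
    have q : ∀ i j, ‖N i j 1‖ ≤ C ^ 2 := fun i j => Qr_norm hx hx0 i j 1 hle'
    have r : ‖Φ 1‖ = 1 / 4 * ‖(P 0 0 1 + P 0 1 1 + P 1 0 1 + P 1 1 1)
        + (N 0 0 1 - N 0 1 1 - N 1 0 1 + N 1 1 1)‖ := by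
      simp only [Φ, norm_smul]; norm_num
    have u : ‖(P 0 0 1 + P 0 1 1 + P 1 0 1 + P 1 1 1) + (N 0 0 1 - N 0 1 1 - N 1 0 1 + N 1 1 1)‖
        ≤ (C ^ 2 + C ^ 2 + C ^ 2 + C ^ 2) + (C ^ 2 + C ^ 2 + C ^ 2 + C ^ 2) :=
      norm_add_le_of_le
        (norm_add_le_of_le (norm_add_le_of_le (norm_add_le_of_le (p _ _) (p _ _)) (p _ _)) (p _ _))
        (norm_add_le_of_le (norm_sub_le_of_le (norm_sub_le_of_le (q _ _) (q _ _)) (q _ _)) (q _ _))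
    rw [r]
    nlinarith [sq_nonneg C]
  · intro s
    have hs : (s : G)⁻¹ ∈ Λ := by
      have h5 : (s : G) ∈ Λ⁻¹ := by rw [hsym]; exact s.2
      exact h5
    have e1 : P 0 1 s = c s := by simp only [P]; rw [Qr_01 hx0, haag_of]
    have e2 : N 0 1 s = - c s := by simp only [N]; rw [Qr_01 hx0, haag_of]
    have hst : star (c ⟨(s : G)⁻¹, hs⟩) = c s := by
      simp only [hcdef]
      rw [hherm s hs, star_smul, star_star]; simp
    have e3 : P 1 0 s = c s := by
      simp only [P]; rw [Qr_10 hx hx0 s hs, haag_of_inv, hst]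
    have e4 : N 1 0 s = - c s := by
      simp only [N]; rw [Qr_10 hx hx0 s hs, haag_of_inv, star_neg, hst]
    have d : ∀ i, ‖P i i s + N i i s‖ ≤ C ^ 2 * (2 * ε ^ 2) := fun i => diag_bound hΛ1 hx hx0 hε₀ hε₁ hc i s
    have r : Φ s - ε • φ s = (1 / 4 : ℂ) • ((P 0 0 s + N 0 0 s) + (P 1 1 s + N 1 1 s)) := by
      have : ε • φ s = c s := rfl
      rw [this]
      simp only [Φ, e1, e2, e3, e4]
      module
    rw [r, norm_smul]
    have u := norm_add_le_of_le (d 0) (d 1)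
    have v : ‖(1 / 4 : ℂ)‖ = 1 / 4 := by norm_num
    rw [v]
    nlinarith [mul_nonneg (sq_nonneg C) (sq_nonneg ε)]

end assembly


theorem completelySidon_keyLemma {G : Type} [Group G] (Λ : Set G)
    (hΛ1 : (1 : G) ∉ Λ) (hsym : Λ⁻¹ = Λ) (C : ℝ) (hΛ : IsCompletelySidon Λ C)
    (A : Type) [CStarAlgebra A] (φ : ↥Λ → A)
    (hherm : ∀ (t : ↥Λ) (h : ((t : G))⁻¹ ∈ Λ), φ ⟨(t : G)⁻¹, h⟩ = star (φ t))
    (M : ℝ) (hM : M < 1) (hbdd : ∀ t, ‖φ t‖ ≤ M)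
    (ε : ℝ) (hε₀ : 0 ≤ ε) (hε₁ : ε ≤ 1) :
    ∃ Φ : G → A, IsCompletelyPosDefFn Φ ∧ ‖Φ 1‖ ≤ 4 * C ^ 2 ∧
      ∀ s : ↥Λ, ‖Φ s - ε • φ s‖ ≤ 4 * C ^ 2 * ε ^ 2 := by
  exact keyLemma_aux hΛ1 hsym hΛ φ hherm (fun t => (hbdd t).trans hM.le) ε hε₀ hε₁
end

section
/- Let Λ be a set, H a complex Hilbert space, and z : Λ → (H →L[ℂ] H) a function with sup_{t∈Λ} ‖z t‖ < 1. For every real ε with 0 < ε ≤ 1 there exist a complex Hilbert space Ĥ, a unitary representation π of FreeGroup Λ on Ĥ, and bounded operators ξ, η : H →L[ℂ] Ĥ with ‖ξ‖·‖η‖ ≤ 1/ε, such that the function Ψ(γ) = (adjoint η) ∘ π(γ) ∘ ξ satisfies Ψ(FreeGroup.of t) = z t for every t ∈ Λ and ‖Ψ(γ)‖ ≤ ε for every γ ∈ FreeGroup Λ not of the form FreeGroup.of t for some t ∈ Λ. (That is, the set of free generators of FreeGroup Λ satisfies the interpolation property of the main interpolation theorem with constant C = 1.) -/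
open ContinuousLinearMap

set_option maxHeartbeats 2000000 in
/-- The regular representation of `G`, tensored with a unitary representation `ρ`. -/
theorem exists_regular (G : Type) [Group G] {E : Type} [NormedAddCommGroup E]
    [InnerProductSpace ℂ E] [CompleteSpace E] (ρ : G →* unitary (E →L[ℂ] E)) :
    ∃ (K : Type) (_ : NormedAddCommGroup K) (_ : InnerProductSpace ℂ K) (_ : CompleteSpace K)
      (l : G →* unitary (K →L[ℂ] K)) (J : G → E →L[ℂ] K),
      (∀ x v, adjoint (J x) (J x v) = v) ∧ (∀ x y v, x ≠ y → adjoint (J x) (J y v) = 0) ∧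
      (∀ g x w, adjoint (J x) ((l g : K →L[ℂ] K) w)
        = (ρ g : E →L[ℂ] E) (adjoint (J (g⁻¹ * x)) w)) := by
  classical
  let K := lp (fun _ : G => E) 2
  have nrm : ∀ (g : G) (v : E), ‖(ρ g : E →L[ℂ] E) v‖ = ‖v‖ := fun g v =>
    (Unitary.linearIsometryEquiv (ρ g)).norm_map v
  have two : (0 : ℝ) < ENNReal.toReal 2 := by norm_num
  have hmem : ∀ (g : G) (f : K), Memℓp (fun x => (ρ g : E →L[ℂ] E) (f (g⁻¹ * x))) 2 := by
    intro g f
    have h := (memℓp_gen_iff two).1 (lp.memℓp f)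
    refine (memℓp_gen_iff two).2 ?_
    simp only [nrm]
    exact (Equiv.mulLeft g⁻¹).summable_iff.2 h
  have rr : ∀ (g h : G) (v : E), (ρ g : E →L[ℂ] E) ((ρ h : E →L[ℂ] E) v)
      = (ρ (g * h) : E →L[ℂ] E) v := by
    intro g h v; simp [map_mul]
  let T : G → K ≃ₗᵢ[ℂ] K := fun g =>
    { toFun := fun f => ⟨fun x => (ρ g : E →L[ℂ] E) (f (g⁻¹ * x)), hmem g f⟩
      map_add' := fun f f' => by ext x; exact map_add (ρ g).1 _ _
      map_smul' := fun c f => by ext x; exact map_smul (ρ g).1 c _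
      invFun := fun f => ⟨fun x => (ρ g⁻¹ : E →L[ℂ] E) (f ((g⁻¹)⁻¹ * x)), hmem g⁻¹ f⟩
      left_inv := fun f => by
        ext x
        change (ρ g⁻¹ : E →L[ℂ] E) ((ρ g : E →L[ℂ] E) (f (g⁻¹ * ((g⁻¹)⁻¹ * x)))) = f x
        rw [rr]; simp
      right_inv := fun f => by
        ext x
        change (ρ g : E →L[ℂ] E) ((ρ g⁻¹ : E →L[ℂ] E) (f ((g⁻¹)⁻¹ * (g⁻¹ * x)))) = f x
        rw [rr]; simp
      norm_map' := fun f => by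
        rw [lp.norm_eq_tsum_rpow two, lp.norm_eq_tsum_rpow two]
        congr 1
        change ∑' x, ‖(ρ g : E →L[ℂ] E) (f (g⁻¹ * x))‖ ^ _ = _
        simp only [nrm]
        exact (Equiv.mulLeft g⁻¹).tsum_eq (fun x => ‖f x‖ ^ (ENNReal.toReal 2)) }
  have Tap : ∀ g f x, (T g f : K) x = (ρ g : E →L[ℂ] E) (f (g⁻¹ * x)) := fun _ _ _ => rfl
  let Th : G →* (K ≃ₗᵢ[ℂ] K) :=
    { toFun := T
      map_one' := by
        ext f x
        change (ρ 1 : E →L[ℂ] E) (f (1⁻¹ * x)) = f x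
        rw [map_one, inv_one, one_mul]; rfl
      map_mul' := fun g h => by
        ext f x
        change T (g * h) f x = T g (T h f) x
        rw [Tap, Tap, Tap, rr, mul_inv_rev, mul_assoc] }
  let J : G → E →L[ℂ] K := fun x =>
    LinearMap.mkContinuous (lp.lsingle (𝕜 := ℂ) (E := fun _ : G => E) 2 x) 1 (fun v => by
      rw [one_mul]; exact (lp.norm_single (E := fun _ : G => E) (p := 2) (by norm_num) x v).le)
  have Jap : ∀ x v, J x v = lp.single 2 x v := fun _ _ => rfl
  have hadj : ∀ x (f : K), adjoint (J x) f = f x := by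
    intro x f
    refine ext_inner_left ℂ fun v => ?_
    rw [adjoint_inner_right, Jap, lp.inner_single_left]
  refine ⟨K, inferInstance, inferInstance, inferInstance,
    (Unitary.linearIsometryEquiv (𝕜 := ℂ) (H := K)).symm.toMonoidHom.comp Th, J, ?_, ?_, ?_⟩
  · intro x v
    rw [hadj, Jap, lp.single_apply_self]
  · intro x y v h
    rw [hadj, Jap, lp.single_apply_ne _ _ _ h]
  · intro g x w
    rw [hadj, hadj]
    rfl

/-- The reflection `1 - N N^*` is unitary when `N^* N = 2`. -/
theorem exists_reflection {E K : Type} [NormedAddCommGroup E] [InnerProductSpace ℂ E]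
    [CompleteSpace E] [NormedAddCommGroup K] [InnerProductSpace ℂ K] [CompleteSpace K]
    (N : E →L[ℂ] K) (h : ∀ v, adjoint N (N v) = (2 : ℂ) • v) :
    ∃ R : unitary (K →L[ℂ] K), star R = R ∧
      ∀ w, (R : K →L[ℂ] K) w = w - N (adjoint N w) := by
  let R : K →L[ℂ] K := 1 - N ∘L adjoint N
  have hs : star R = R := by
    change star (1 - N ∘L adjoint N) = _
    rw [star_sub, star_one, star_eq_adjoint, adjoint_comp, adjoint_adjoint]
  have h2 : R * R = 1 := by
    ext w
    change (w - N (adjoint N w)) - N (adjoint N (w - N (adjoint N w))) = w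
    rw [map_sub, h, map_sub, map_smul]
    module
  refine ⟨⟨R, ?_⟩, ?_, fun w => rfl⟩
  · rw [Unitary.mem_iff, hs]; exact ⟨h2, h2⟩
  · ext1; exact hs

theorem toWord_cons_mul {Λ : Type} [DecidableEq Λ] (t : Λ) (b : Bool) (x : FreeGroup Λ)
    (h : x.toWord.head? ≠ some (t, !b)) :
    (FreeGroup.mk [(t, b)] * x).toWord = (t, b) :: x.toWord := by
  rw [FreeGroup.toWord_mul, FreeGroup.toWord_mk, FreeGroup.reduce_singleton, List.singleton_append]
  apply FreeGroup.IsReduced.reduce_eq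
  have hx : FreeGroup.IsReduced x.toWord := FreeGroup.isReduced_toWord
  revert h hx
  cases x.toWord with
  | nil => intro _ _; exact FreeGroup.IsReduced.singleton
  | cons a L =>
    intro h hx
    rw [FreeGroup.isReduced_cons_cons]
    refine ⟨fun e => ?_, hx⟩
    by_contra hne
    apply h
    obtain ⟨a1, a2⟩ := a
    simp at e hne ⊢
    cases a2 <;> cases b <;> simp_all

/-- The Riesz product representation. -/
theorem exists_riesz {Λ : Type} [DecidableEq Λ] {E : Type} [NormedAddCommGroup E]
    [InnerProductSpace ℂ E] [CompleteSpace E] (ρ : FreeGroup Λ →* unitary (E →L[ℂ] E))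
    (ε : ℝ) (h0 : 0 < ε) (h1 : ε ≤ 1) :
    ∃ (K : Type) (_ : NormedAddCommGroup K) (_ : InnerProductSpace ℂ K) (_ : CompleteSpace K)
      (π : FreeGroup Λ →* unitary (K →L[ℂ] K)) (J : E →L[ℂ] K),
      (∀ v, adjoint J (J v) = v) ∧
      ∀ γ v, adjoint J ((π γ : K →L[ℂ] K) (J v))
        = ((ε : ℂ) ^ γ.toWord.length) • (ρ γ : E →L[ℂ] E) v := by
  obtain ⟨K, i1, i2, i3, l, J, hJ1, hJ0, hl⟩ := exists_regular (FreeGroup Λ) ρ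
  obtain ⟨p, q, hpq2, hpq⟩ : ∃ p q : ℝ, p ^ 2 + q ^ 2 = 2 ∧ p * q = ε := by
    have a := Real.sq_sqrt (show 0 ≤ (1 + ε) / 2 by linarith)
    have b := Real.sq_sqrt (show 0 ≤ (1 - ε) / 2 by linarith)
    exact ⟨√((1 + ε) / 2) + √((1 - ε) / 2), √((1 + ε) / 2) - √((1 - ε) / 2),
      by linear_combination 2 * a + 2 * b, by linear_combination a - b⟩
  have hone : ∀ t : Λ, (1 : FreeGroup Λ) ≠ (FreeGroup.of t)⁻¹ := by
    intro t h
    exact FreeGroup.of_ne_one t (inv_eq_one.1 h.symm)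
  let N : Λ → E →L[ℂ] K := fun t => (p : ℂ) • J 1 - (q : ℂ) • J (FreeGroup.of t)⁻¹
  have hNa : ∀ t w, adjoint (N t) w
      = (p : ℂ) • adjoint (J 1) w - (q : ℂ) • adjoint (J (FreeGroup.of t)⁻¹) w := by
    intro t w
    have : adjoint (N t)
        = (p : ℂ) • adjoint (J 1) - (q : ℂ) • adjoint (J (FreeGroup.of t)⁻¹) := by
      simp only [N, map_sub, LinearIsometryEquiv.map_smulₛₗ, Complex.conj_ofReal]
    rw [this]; rfl
  have hNN : ∀ t v, adjoint (N t) (N t v) = (2 : ℂ) • v := by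
    intro t v
    have e : N t v = (p : ℂ) • J 1 v - (q : ℂ) • J (FreeGroup.of t)⁻¹ v := rfl
    rw [hNa, e]
    simp only [map_sub, map_smul, hJ1, hJ0 _ _ _ (hone t), hJ0 _ _ _ (hone t).symm]
    have : (2 : ℂ) = p ^ 2 + q ^ 2 := by exact_mod_cast hpq2.symm
    rw [this]
    module
  choose R hRs hR using fun t => exists_reflection (N t) (hNN t)
  -- coordinates of `R t w`
  have hR1 : ∀ t w, adjoint (J 1) ((R t : K →L[ℂ] K) w)
      = adjoint (J 1) w - (p : ℂ) • adjoint (N t) w := by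
    intro t w
    have e : ∀ v, N t v = (p : ℂ) • J 1 v - (q : ℂ) • J (FreeGroup.of t)⁻¹ v := fun _ => rfl
    rw [hR, e]
    simp only [map_sub, map_smul, hJ1, hJ0 _ _ _ (hone t), smul_zero, sub_zero]
  have hRt : ∀ t w, adjoint (J (FreeGroup.of t)⁻¹) ((R t : K →L[ℂ] K) w)
      = adjoint (J (FreeGroup.of t)⁻¹) w + (q : ℂ) • adjoint (N t) w := by
    intro t w
    have e : ∀ v, N t v = (p : ℂ) • J 1 v - (q : ℂ) • J (FreeGroup.of t)⁻¹ v := fun _ => rfl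
    rw [hR, e]
    simp only [map_sub, map_smul, hJ1, hJ0 _ _ _ (hone t).symm, smul_zero]
    abel
  have hRx : ∀ t w x, x ≠ 1 → x ≠ (FreeGroup.of t)⁻¹ →
      adjoint (J x) ((R t : K →L[ℂ] K) w) = adjoint (J x) w := by
    intro t w x h h'
    have e : ∀ v, N t v = (p : ℂ) • J 1 v - (q : ℂ) • J (FreeGroup.of t)⁻¹ v := fun _ => rfl
    rw [hR, e]
    simp only [map_sub, map_smul, hJ0 _ _ _ h, hJ0 _ _ _ h', smul_zero, sub_zero]
  let π : FreeGroup Λ →* unitary (K →L[ℂ] K) := FreeGroup.lift fun t => l (FreeGroup.of t) * R t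
  have hπt : ∀ t γ w, ((π (FreeGroup.of t * γ) : unitary (K →L[ℂ] K)) : K →L[ℂ] K) w
      = (l (FreeGroup.of t) : K →L[ℂ] K) ((R t : K →L[ℂ] K) ((π γ : K →L[ℂ] K) w)) := by
    intro t γ w
    simp [π]
  have hπi : ∀ t γ w, ((π ((FreeGroup.of t)⁻¹ * γ) : unitary (K →L[ℂ] K)) : K →L[ℂ] K) w
      = (R t : K →L[ℂ] K) ((l (FreeGroup.of t)⁻¹ : K →L[ℂ] K) ((π γ : K →L[ℂ] K) w)) := by
    intro t γ w
    have e : π ((FreeGroup.of t)⁻¹ * γ) = R t * (l (FreeGroup.of t)⁻¹ * π γ) := by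
      rw [map_mul, map_inv, map_inv]
      have : π (FreeGroup.of t) = l (FreeGroup.of t) * R t := by simp [π]
      rw [this, mul_inv_rev, mul_assoc, ← Unitary.star_eq_inv (R t), hRs]
    rw [e]; rfl
  have hmt : ∀ t : Λ, FreeGroup.mk [(t, true)] = FreeGroup.of t := fun _ => rfl
  have hmf : ∀ t : Λ, FreeGroup.mk [(t, false)] = (FreeGroup.of t)⁻¹ := fun _ => rfl
  have hwt : ∀ t : Λ, (FreeGroup.of t).toWord = [(t, true)] := FreeGroup.toWord_of
  have hwf : ∀ t : Λ, ((FreeGroup.of t)⁻¹).toWord = [(t, false)] := fun _ => rfl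
  have key : ∀ (L : List (Λ × Bool)), FreeGroup.IsReduced L → ∀ v : E,
      adjoint (J 1) ((π (FreeGroup.mk L) : K →L[ℂ] K) (J 1 v))
        = ((ε : ℂ) ^ L.length) • (ρ (FreeGroup.mk L) : E →L[ℂ] E) v ∧
      ∀ x, x ≠ 1 → x.toWord.head? ≠ L.head? →
        adjoint (J x) ((π (FreeGroup.mk L) : K →L[ℂ] K) (J 1 v)) = 0 := by
    intro L
    induction L with
    | nil =>
      intro _ v
      rw [← FreeGroup.one_eq_mk, map_one, map_one]
      refine ⟨?_, fun x hx _ => ?_⟩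
      · simpa using hJ1 1 v
      · simpa using hJ0 x 1 v hx
    | cons s L ih =>
      intro hL v
      obtain ⟨t, b⟩ := s
      have hL' : FreeGroup.IsReduced L := hL.infix ⟨[(t, b)], [], by simp⟩
      have hhead : some (t, !b) ≠ L.head? := by
        cases L with
        | nil => simp
        | cons a L =>
          rw [FreeGroup.isReduced_cons_cons] at hL
          intro e
          simp at e
          have := hL.1
          rw [← e] at this
          simp at this
      obtain ⟨ih1, ih0⟩ := ih hL' v
      have hmk : FreeGroup.mk ((t, b) :: L) = FreeGroup.mk [(t, b)] * FreeGroup.mk L := rfl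
      have hρ : ∀ g h : FreeGroup Λ, (ρ (g * h) : E →L[ℂ] E) v
          = (ρ g : E →L[ℂ] E) ((ρ h : E →L[ℂ] E) v) := by
        intro g h; simp
      have hε : (ε : ℂ) = p * q := by rw [← hpq]; push_cast; rfl
      rw [hmk, hρ]
      generalize FreeGroup.mk L = γ at *
      cases b with
      | true =>
        rw [hmt, hπt]
        set f := (π γ : K →L[ℂ] K) (J 1 v) with hf
        have ft : adjoint (J (FreeGroup.of t)⁻¹) f = 0 :=
          ih0 _ (hone t).symm (by rw [hwf]; exact hhead)
        constructor
        · rw [hl, mul_one, hRt, hNa, ft, ih1, List.length_cons, pow_succ]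
          simp only [map_smul, smul_zero, sub_zero, zero_add]
          rw [hε]; module
        · intro x hx hxh
          have hw := toWord_cons_mul t false x hxh
          rw [hmf] at hw
          rw [hl, hRx, ih0, map_zero]
          · intro e; rw [e] at hw; simp at hw
          · rw [hw]; exact hhead
          · intro e; rw [e] at hw; simp at hw
          · intro e; exact hx (by simpa using e)
      | false =>
        rw [hmf, hπi]
        set f := (π γ : K →L[ℂ] K) (J 1 v) with hf
        have ft : adjoint (J (FreeGroup.of t)) f = 0 :=
          ih0 _ (FreeGroup.of_ne_one t) (by rw [hwt]; exact hhead)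
        constructor
        · rw [hR1, hNa, hl, hl, inv_inv, mul_one, mul_inv_cancel, ft, ih1, List.length_cons,
            pow_succ]
          simp only [map_smul, map_zero, smul_zero, zero_sub]
          rw [hε]; module
        · intro x hx hxh
          have hw := toWord_cons_mul t true x hxh
          rw [hmt] at hw
          rw [hRx _ _ _ hx, hl, inv_inv, ih0, map_zero]
          · intro e; rw [e] at hw; simp at hw
          · rw [hw]; exact hhead
          · intro e; rw [e] at hxh; exact hxh (by rw [hwf]; rfl)
  refine ⟨K, i1, i2, i3, π, J 1, hJ1 1, fun γ v => ?_⟩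
  have := (key γ.toWord FreeGroup.isReduced_toWord v).1
  rwa [FreeGroup.mk_toWord] at this

theorem exists_dilation {Λ : Type} {H : Type} [NormedAddCommGroup H] [InnerProductSpace ℂ H]
    [CompleteSpace H] (z : Λ → H →L[ℂ] H) (hz : ∀ t, ‖z t‖ ≤ 1) :
    ∃ (K : Type) (_ : NormedAddCommGroup K) (_ : InnerProductSpace ℂ K) (_ : CompleteSpace K)
      (π : FreeGroup Λ →* unitary (K →L[ℂ] K)) (ξ η : H →L[ℂ] K),
      (∀ v, adjoint ξ (ξ v) = v) ∧ (∀ v, adjoint η (η v) = v) ∧ (∀ v, adjoint η (ξ v) = 0) ∧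
      (∀ t v, adjoint η ((π (FreeGroup.of t) : K →L[ℂ] K) (ξ v)) = z t v) ∧
      (∀ t v, adjoint η ((π (FreeGroup.of t)⁻¹ : K →L[ℂ] K) (ξ v)) = 0) := by
  obtain ⟨K, i1, i2, i3, -, J, hJ1, hJ0, -⟩ :=
    exists_regular (Multiplicative (ZMod 3)) (1 : _ →* unitary (H →L[ℂ] H))
  obtain ⟨A, B, C, hAB, hAC, hBC⟩ : ∃ A B C : Multiplicative (ZMod 3), A ≠ B ∧ A ≠ C ∧ B ≠ C :=
    ⟨Multiplicative.ofAdd 0, Multiplicative.ofAdd 1, Multiplicative.ofAdd 2, by decide,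
      by decide, by decide⟩
  obtain ⟨σ, hσs, hσ⟩ := exists_reflection (J B - J C) (fun v => by
    simp only [map_sub, sub_apply, hJ1, hJ0 _ _ _ hBC, hJ0 _ _ _ hBC.symm]
    module)
  let T : Λ → K →L[ℂ] K := fun t =>
    J B ∘L z t ∘L adjoint (J A) + J A ∘L adjoint (z t) ∘L adjoint (J B)
  have hT : ∀ t w, T t w = J B (z t (adjoint (J A) w)) + J A (adjoint (z t) (adjoint (J B) w)) :=
    fun _ _ => rfl
  have hTs : ∀ t, IsSelfAdjoint (T t) := by
    intro t
    rw [isSelfAdjoint_iff, star_eq_adjoint]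
    simp only [T, map_add, adjoint_comp, adjoint_adjoint, comp_assoc]
    rw [add_comm]
  have iso : ∀ x v, ‖J x v‖ = ‖v‖ := by
    intro x v
    have : inner ℂ (J x v) (J x v) = inner ℂ v v := by
      rw [← adjoint_inner_right, hJ1]
    rw [@norm_eq_sqrt_re_inner ℂ, this, ← @norm_eq_sqrt_re_inner ℂ]
  have pyth : ∀ v w, ‖J B v + J A w‖ ^ 2 = ‖v‖ ^ 2 + ‖w‖ ^ 2 := by
    intro v w
    have : inner ℂ (J B v) (J A w) = 0 := by
      rw [← adjoint_inner_right, hJ0 _ _ _ hAB.symm, inner_zero_right]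
    have := norm_add_sq_eq_norm_sq_add_norm_sq_of_inner_eq_zero _ _ this
    rw [iso, iso] at this
    linear_combination this
  have bes : ∀ w, ‖adjoint (J A) w‖ ^ 2 + ‖adjoint (J B) w‖ ^ 2 ≤ ‖w‖ ^ 2 := by
    intro w
    set u := J B (adjoint (J B) w) + J A (adjoint (J A) w) with hu
    have : inner ℂ u (w - u) = 0 := by
      rw [hu, inner_add_left, ← adjoint_inner_right (J B), ← adjoint_inner_right (J A)]
      simp only [map_sub, map_add, hJ1, hJ0 _ _ _ hAB, hJ0 _ _ _ hAB.symm]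
      simp
    have := norm_add_sq_eq_norm_sq_add_norm_sq_of_inner_eq_zero _ _ this
    rw [add_sub_cancel] at this
    have h2 := pyth (adjoint (J B) w) (adjoint (J A) w)
    rw [← hu] at h2
    nlinarith [mul_self_nonneg ‖w - u‖]
  have hTn : ∀ t, ‖T t‖ ≤ 1 := by
    intro t
    refine opNorm_le_bound _ zero_le_one fun w => ?_
    rw [one_mul]
    refine le_of_sq_le_sq ?_ (norm_nonneg _)
    rw [hT, pyth]
    refine le_trans ?_ (bes w)
    have a1 : ‖z t (adjoint (J A) w)‖ ≤ ‖adjoint (J A) w‖ :=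
      (le_of_opNorm_le _ (hz t) _).trans (by rw [one_mul])
    have a2 : ‖adjoint (z t) (adjoint (J B) w)‖ ≤ ‖adjoint (J B) w‖ :=
      (le_of_opNorm_le (adjoint (z t)) (c := 1)
        ((LinearIsometryEquiv.norm_map _ _).trans_le (hz t)) _).trans (by rw [one_mul])
    gcongr
  let Q : K →L[ℂ] K := J A ∘L adjoint (J A)
  let S : Λ → K →L[ℂ] K := fun t => CFC.sqrt (1 - T t ^ 2)
  have hSQ : ∀ t, Commute (S t) Q := by
    intro t
    have : Commute (1 - T t ^ 2) Q := by
      refine (Commute.one_left _).sub_left ?_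
      change T t ^ 2 * Q = Q * T t ^ 2
      ext w
      change T t (T t (J A (adjoint (J A) w))) = J A (adjoint (J A) (T t (T t w)))
      simp only [hT, map_add, hJ1, hJ0 _ _ _ hAB, hJ0 _ _ _ hAB.symm, map_zero, add_zero, zero_add]
    exact this.cfcₙ_nnreal _
  have hS : ∀ t x v, x ≠ A → adjoint (J x) (S t (J A v)) = 0 := by
    intro t x v hx
    have h1 : S t (J A v) = Q (S t (J A v)) := by
      have := congrArg (fun f : K →L[ℂ] K => f (J A v)) (hSQ t).eq
      change S t (J A (adjoint (J A) (J A v))) = Q (S t (J A v)) at this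
      rwa [hJ1] at this
    rw [h1]
    exact hJ0 _ _ _ hx
  let W : Λ → unitary (K →L[ℂ] K) := fun t =>
    selfAdjoint.unitarySelfAddISMul ⟨T t, hTs t⟩ (hTn t)
  have hW : ∀ t w, (W t : K →L[ℂ] K) w = T t w + Complex.I • S t w := fun _ _ => rfl
  have hWi : ∀ t w, (((W t)⁻¹ : unitary (K →L[ℂ] K)) : K →L[ℂ] K) w = T t w - Complex.I • S t w := by
    intro t w
    have := selfAdjoint.star_coe_unitarySelfAddISMul ⟨T t, hTs t⟩ (hTn t)
    exact congrArg (fun f : K →L[ℂ] K => f w) this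
  let π : FreeGroup Λ →* unitary (K →L[ℂ] K) := FreeGroup.lift fun t => σ * W t
  have hπ : ∀ t, π (FreeGroup.of t) = σ * W t := by intro t; simp [π]
  refine ⟨K, i1, i2, i3, π, J A, J C, hJ1 A, hJ1 C, fun v => hJ0 _ _ _ hAC.symm, ?_, ?_⟩
  · intro t v
    rw [hπ]
    change adjoint (J C) ((σ : K →L[ℂ] K) ((W t : K →L[ℂ] K) (J A v))) = _
    rw [hσ, hW]
    simp only [hT, map_sub, sub_apply, map_add, map_smul, hJ1, hJ0 _ _ _ hBC, hJ0 _ _ _ hBC.symm,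
      hJ0 _ _ _ hAC.symm, hJ0 _ _ _ hAB.symm, hS _ _ _ hAB.symm, hS _ _ _ hAC.symm, map_zero,
      smul_zero]
    simp
  · intro t v
    have : π (FreeGroup.of t)⁻¹ = (W t)⁻¹ * σ := by
      rw [map_inv, hπ, mul_inv_rev, ← Unitary.star_eq_inv σ, hσs]
    rw [this]
    change adjoint (J C) ((((W t)⁻¹ : unitary (K →L[ℂ] K)) : K →L[ℂ] K)
      ((σ : K →L[ℂ] K) (J A v))) = _
    rw [hσ, hWi]
    simp only [hT, map_sub, sub_apply, map_add, map_smul, hJ1, hJ0 _ _ _ hBC, hJ0 _ _ _ hBC.symm,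
      hJ0 _ _ _ hAC.symm, hJ0 _ _ _ hAB.symm, hS _ _ _ hAB.symm, hS _ _ _ hAC.symm, map_zero,
      smul_zero]
    simp [hJ0 _ _ _ hAC.symm, hJ0 _ _ _ hAB.symm, hJ0 _ _ _ hBC.symm, hS _ _ _ hAC.symm]

theorem norm_le_one_of_isometry {E K : Type} [NormedAddCommGroup E] [InnerProductSpace ℂ E]
    [CompleteSpace E] [NormedAddCommGroup K] [InnerProductSpace ℂ K] [CompleteSpace K]
    (J : E →L[ℂ] K) (h : ∀ v, adjoint J (J v) = v) : ‖J‖ ≤ 1 := by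
  refine opNorm_le_bound _ zero_le_one fun v => ?_
  have : inner ℂ (J v) (J v) = inner ℂ v v := by
    rw [← adjoint_inner_right, h]
  rw [@norm_eq_sqrt_re_inner ℂ, this, ← @norm_eq_sqrt_re_inner ℂ, one_mul]

theorem norm_unitary_le {K : Type} [NormedAddCommGroup K] [InnerProductSpace ℂ K] [CompleteSpace K]
    (u : unitary (K →L[ℂ] K)) : ‖(u : K →L[ℂ] K)‖ ≤ 1 := by
  refine opNorm_le_bound _ zero_le_one fun v => ?_
  rw [one_mul]
  exact ((Unitary.linearIsometryEquiv u).norm_map v).le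


theorem freeGroup_generators_interpolation_operatorValued (Λ : Type)
    {H : Type} [NormedAddCommGroup H] [InnerProductSpace ℂ H] [CompleteSpace H]
    (z : Λ → H →L[ℂ] H) (M : ℝ) (hM : M < 1) (hz : ∀ t, ‖z t‖ ≤ M)
    (ε : ℝ) (hε₀ : 0 < ε) (hε₁ : ε ≤ 1) :
    ∃ (K : Type) (_ : NormedAddCommGroup K) (_ : InnerProductSpace ℂ K) (_ : CompleteSpace K)
      (π : FreeGroup Λ →* unitary (K →L[ℂ] K)) (ξ η : H →L[ℂ] K),
      ‖ξ‖ * ‖η‖ ≤ 1 / ε ∧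
      (∀ t : Λ,
        (ContinuousLinearMap.adjoint η).comp
          (((π (FreeGroup.of t) : unitary (K →L[ℂ] K)) : K →L[ℂ] K).comp ξ) = z t) ∧
      (∀ γ : FreeGroup Λ, (∀ t : Λ, γ ≠ FreeGroup.of t) →
        ‖(ContinuousLinearMap.adjoint η).comp
          (((π γ : unitary (K →L[ℂ] K)) : K →L[ℂ] K).comp ξ)‖ ≤ ε) := by
  classical
  obtain ⟨E, e1, e2, e3, ρ, ξ, η, hξ, hη, hηξ, hgen, hinv⟩ :=
    exists_dilation z (fun t => (hz t).trans hM.le)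
  obtain ⟨K, k1, k2, k3, π, J, hJ, hπ⟩ := exists_riesz ρ ε hε₀ hε₁
  have hεc : (ε : ℂ) ≠ 0 := by exact_mod_cast hε₀.ne'
  have nξ := norm_le_one_of_isometry ξ hξ
  have nη := norm_le_one_of_isometry η hη
  have nJ := norm_le_one_of_isometry J hJ
  have hform : ∀ γ, (ContinuousLinearMap.adjoint (((ε : ℂ)⁻¹) • (J ∘L η))).comp
      (((π γ : unitary (K →L[ℂ] K)) : K →L[ℂ] K).comp (J ∘L ξ))
      = ((ε : ℂ)⁻¹ * (ε : ℂ) ^ γ.toWord.length) •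
        (adjoint η ∘L (ρ γ : E →L[ℂ] E) ∘L ξ) := by
    intro γ
    ext v
    have : ContinuousLinearMap.adjoint (((ε : ℂ)⁻¹) • (J ∘L η))
        = ((ε : ℂ)⁻¹) • (adjoint η ∘L adjoint J) := by
      rw [LinearIsometryEquiv.map_smulₛₗ, adjoint_comp]
      simp
    rw [this]
    change (ε : ℂ)⁻¹ • adjoint η (adjoint J ((π γ : K →L[ℂ] K) (J (ξ v)))) = 
      ((ε : ℂ)⁻¹ * (ε : ℂ) ^ γ.toWord.length) • adjoint η ((ρ γ : E →L[ℂ] E) (ξ v))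
    rw [hπ, map_smul, smul_smul]
  refine ⟨K, k1, k2, k3, π, J ∘L ξ, ((ε : ℂ)⁻¹) • (J ∘L η), ?_, ?_, ?_⟩
  · have a : ‖J ∘L ξ‖ ≤ 1 :=
      (opNorm_comp_le _ _).trans (mul_le_one₀ nJ (norm_nonneg _) nξ)
    have b : ‖J ∘L η‖ ≤ 1 :=
      (opNorm_comp_le _ _).trans (mul_le_one₀ nJ (norm_nonneg _) nη)
    have c : ‖(ε : ℂ)⁻¹‖ = 1 / ε := by
      rw [norm_inv, Complex.norm_real, Real.norm_of_nonneg hε₀.le, one_div]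
    rw [norm_smul, c]
    have d : 0 ≤ 1 / ε := by positivity
    calc ‖J ∘L ξ‖ * (1 / ε * ‖J ∘L η‖) ≤ 1 * (1 / ε * 1) := by gcongr
      _ = 1 / ε := by ring
  · intro t
    rw [hform, FreeGroup.toWord_of]
    ext v
    simpa [hεc] using hgen t v
  · intro γ hγ
    rw [hform]
    have nz : ∀ δ : FreeGroup Λ, (∀ v, adjoint η ((ρ δ : E →L[ℂ] E) (ξ v)) = 0) →
        adjoint η ∘L (ρ δ : E →L[ℂ] E) ∘L ξ = 0 := by
      intro δ h; ext v; exact h v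
    have nle : ‖adjoint η ∘L (ρ γ : E →L[ℂ] E) ∘L ξ‖ ≤ 1 := by
      refine (opNorm_comp_le _ _).trans (mul_le_one₀ ?_ (norm_nonneg _) ?_)
      · rw [LinearIsometryEquiv.norm_map]; exact nη
      · exact (opNorm_comp_le _ _).trans (mul_le_one₀ (norm_unitary_le _) (norm_nonneg _) nξ)
    have hmk : FreeGroup.mk γ.toWord = γ := FreeGroup.mk_toWord
    rcases hw : γ.toWord with _ | ⟨⟨t, b⟩, _ | ⟨s, L⟩⟩
    · rw [hw] at hmk
      have h1 : γ = 1 := by rw [← hmk]; rfl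
      rw [nz γ (by rw [h1, map_one]; exact hηξ)]
      simpa using hε₀.le
    · rw [hw] at hmk
      cases b with
      | true => exact absurd hmk.symm (hγ t)
      | false =>
        have h1 : γ = (FreeGroup.of t)⁻¹ := by rw [← hmk]; rfl
        rw [nz γ (by rw [h1]; exact hinv t)]
        simpa using hε₀.le
    · have e : (ε : ℂ)⁻¹ * (ε : ℂ) ^ ((t, b) :: s :: L).length = ((ε * ε ^ L.length : ℝ) : ℂ) := by
        simp only [List.length_cons, pow_succ]
        push_cast
        field_simp
      rw [e, norm_smul, Complex.norm_real, Real.norm_of_nonneg (by positivity)]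
      have : ε ^ L.length ≤ 1 := pow_le_one₀ hε₀.le hε₁
      calc ε * ε ^ L.length * _ ≤ ε * 1 * 1 := by gcongr
        _ = ε := by ring
end
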